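/- arXiv:1807.00222 — 3 statements merged into one kernel-verified Lean document; each statement's English description precedes it below -/
import Mathlib

section
/- Let X be a regular curve and f : X → X a homeomorphism. Then the non-wandering set Ω(f) is equal to the set R(f) of recurrent points of f. -/
open Set Filter Metric Topology

/-- The defining condition of a regular curve: every point has arbitrarily small
open neighborhoods with finite boundary. (Together with the instance assumptions
`Nonempty`, `CompactSpace`, `ConnectedSpace` on a metric space, this says `X` is a
regular curve.) -/
def regularCurveAx (X : Type*) [MetricSpace X] : Prop :=
  ∀ (x : X) (V : Set X), IsOpen V → x ∈ V →
    ∃ U : Set X, IsOpen U ∧ x ∈ U ∧ U ⊆ V ∧ (frontier U).Finite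

/-- The ω-limit set of `x` under `f`: all limits of `f^[n i] x` along a strictly
increasing sequence of integers `n`. -/
def omegaSet {X : Type*} [MetricSpace X] (f : X → X) (x : X) : Set X :=
  {y | ∃ n : ℕ → ℕ, StrictMono n ∧ Tendsto (fun i => f^[n i] x) atTop (𝓝 y)}

/-- `M` is a minimal set of `f`: nonempty, closed, strongly invariant, and without
any proper nonempty closed strongly invariant subset. -/
def IsMinimalSet {X : Type*} [MetricSpace X] (f : X → X) (M : Set X) : Prop :=
  M.Nonempty ∧ IsClosed M ∧ f '' M = M ∧
    ∀ N : Set X, N ⊆ M → N.Nonempty → IsClosed N → f '' N = N → N = M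

/-- In a connected space, a point lying in an open set `U` with finite frontier has a connected
neighborhood contained in `closure U`. -/
theorem exists_preconnected_nhds_subset_closure {X : Type*} [TopologicalSpace X]
    [ConnectedSpace X] {U : Set X} (hU : IsOpen U) (hfin : (frontier U).Finite) {x : X}
    (hx : x ∈ U) : ∃ Q ∈ 𝓝 x, Q ⊆ closure U ∧ IsPreconnected Q := by
  let S : Set (Set X) :=
    {Q | IsClosed Q ∧ IsClosed (closure U \ Q) ∧ Q ⊆ closure U ∧ x ∈ Q}
  have hS : S.Nonempty :=
    ⟨closure U, isClosed_closure, by simp, Subset.rfl, subset_closure hx⟩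
  obtain ⟨Q, ⟨hQc, hQc', hQU, hxQ⟩, hmin⟩ :=
    exists_minimalFor_of_wellFoundedLT (· ∈ S) (fun Q => (Q ∩ frontier U).ncard) hS
  refine ⟨Q, ?_, hQU, ?_⟩
  · have : U ∩ (closure U \ Q)ᶜ ∈ 𝓝 x :=
      (hU.inter hQc'.isOpen_compl).mem_nhds ⟨hx, fun h => h.2 hxQ⟩
    refine mem_of_superset this ?_
    rintro y ⟨hyU, hy⟩
    by_contra hyQ
    exact hy ⟨subset_closure hyU, hyQ⟩
  · have key : ∀ A B : Set X, IsClosed A → IsClosed B → Disjoint A B → A ∪ B = Q → x ∈ A →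
        B = ∅ := by
      intro A B hA hB hAB hQ hxA
      have hYA : closure U \ A = (closure U \ Q) ∪ B := by
        have hBU : B ⊆ closure U := (subset_union_right.trans hQ.le).trans hQU
        ext y
        have h1 := @hBU y
        have h2 := fun h : y ∈ A => disjoint_left.1 hAB h
        simp only [← hQ, Set.mem_sdiff, mem_union]
        tauto
      have hAS : A ∈ S :=
        ⟨hA, hYA ▸ hQc'.union hB, (subset_union_left.trans hQ.le).trans hQU, hxA⟩
      have hAQ : A ∩ frontier U ⊆ Q ∩ frontier U :=
        inter_subset_inter_left _ (subset_union_left.trans hQ.le)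
      have hle : (A ∩ frontier U).ncard ≤ (Q ∩ frontier U).ncard :=
        ncard_le_ncard hAQ (hfin.inter_of_right _)
      have heq := eq_of_subset_of_ncard_le hAQ (hmin hAS hle) (hfin.inter_of_right _)
      have hBF : ∀ y ∈ B, y ∉ frontier U := fun y hy hyF => by
        have : y ∈ A ∩ frontier U := heq ▸ ⟨hQ.le (Or.inr hy), hyF⟩
        exact disjoint_left.1 hAB this.1 hy
      have hBo : B = U \ (A ∪ (closure U \ Q)) := by
        ext y
        have h1 : y ∈ B → y ∈ U := fun hy => by
          have h := hQU (hQ.le (Or.inr hy))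
          by_contra hyU
          exact hBF y hy ⟨h, by rwa [hU.interior_eq]⟩
        have h2 := fun h : y ∈ A => disjoint_left.1 hAB h
        have h3 : y ∈ U → y ∈ closure U := fun h => subset_closure h
        simp only [← hQ, Set.mem_sdiff, mem_union]
        tauto
      have hclopen : IsClopen B := ⟨hB, by
        rw [hBo]; exact hU.sdiff (hA.union hQc')⟩
      rcases isClopen_iff.1 hclopen with h | h
      · exact h
      · exact absurd (h ▸ mem_univ x) (disjoint_left.1 hAB hxA)
    rw [isPreconnected_closed_iff]
    intro t t' ht ht' hcover hne hne'
    by_contra hcon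
    have hdisj : Disjoint (Q ∩ t) (Q ∩ t') := by
      rw [disjoint_left]
      exact fun y hy hy' => hcon ⟨y, hy.1, hy.2, hy'.2⟩
    have hun : Q ∩ t ∪ Q ∩ t' = Q := by
      rw [← inter_union_distrib_left]; exact inter_eq_left.2 hcover
    rcases hcover hxQ with h | h
    · exact hne'.ne_empty (key _ _ (hQc.inter ht) (hQc.inter ht') hdisj hun ⟨hxQ, h⟩)
    · exact hne.ne_empty (key _ _ (hQc.inter ht') (hQc.inter ht) hdisj.symm
        (by rw [union_comm]; exact hun) ⟨hxQ, h⟩)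

/-- A regular curve has a neighborhood basis of connected sets at every point. -/
theorem regularCurveAx.exists_preconnected_nhds {X : Type*} [MetricSpace X] [ConnectedSpace X]
    (hreg : regularCurveAx X) {x : X} {V : Set X} (hV : V ∈ 𝓝 x) :
    ∃ Q ∈ 𝓝 x, Q ⊆ V ∧ IsPreconnected Q := by
  obtain ⟨K, hK, hKc, hKV⟩ := exists_mem_nhds_isClosed_subset hV
  obtain ⟨U, hU, hxU, hUK, hfin⟩ :=
    hreg x (interior K) isOpen_interior (mem_interior_iff_mem_nhds.2 hK)
  obtain ⟨Q, hQ, hQU, hQp⟩ := exists_preconnected_nhds_subset_closure hU hfin hxU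
  exact ⟨Q, hQ, (hQU.trans (closure_minimal (hUK.trans interior_subset) hKc)).trans hKV, hQp⟩

/-- In a compact regular curve, for each scale some finite set meets every connected set of
large diameter. -/
theorem regularCurveAx.exists_finite_meeting {X : Type*} [MetricSpace X] [CompactSpace X]
    (hreg : regularCurveAx X) {δ : ℝ} (hδ : 0 < δ) :
    ∃ F : Set X, F.Finite ∧ ∀ B : Set X, IsPreconnected B →
      ∀ a ∈ B, ∀ b ∈ B, 2 * δ ≤ dist a b → (B ∩ F).Nonempty := by
  choose U hU hxU hUb hfin using fun x : X => hreg x (ball x δ) isOpen_ball (mem_ball_self hδ)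
  obtain ⟨t, ht⟩ := isCompact_univ.elim_finite_subcover U hU
    (fun x _ => mem_iUnion.2 ⟨x, hxU x⟩)
  refine ⟨⋃ i ∈ t, frontier (U i), t.finite_toSet.biUnion fun i _ => hfin i, ?_⟩
  intro B hB a ha b hb hab
  obtain ⟨i, hit, hai⟩ := mem_iUnion₂.1 (ht (mem_univ a))
  have hbi : b ∉ U i := fun hbi => by
    have h1 := mem_ball.1 (hUb i hai)
    have h2 := mem_ball'.1 (hUb i hbi)
    linarith [dist_triangle a i b]
  by_contra hcon
  have hd : B ∩ frontier (U i) = ∅ := by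
    by_contra h
    obtain ⟨y, hyB, hy⟩ := nonempty_iff_ne_empty.2 h
    exact hcon ⟨y, hyB, mem_iUnion₂.2 ⟨i, hit, hy⟩⟩
  have hsub : B ⊆ U i ∪ (closure (U i))ᶜ := by
    intro y hy
    by_contra h
    simp only [mem_union, mem_compl_iff, not_or, not_not] at h
    exact (hd ▸ (⟨hy, h.2, by rw [(hU i).interior_eq]; exact h.1⟩ :
      y ∈ B ∩ frontier (U i)) : y ∈ (∅ : Set X))
  obtain ⟨y, -, hy, hy'⟩ := hB _ _ (hU i) isClosed_closure.isOpen_compl hsub ⟨a, ha, hai⟩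
    ⟨b, hb, (hsub hb).resolve_left hbi⟩
  exact hy' (subset_closure hy)

/-- A point which is not in its own ω-limit set has a neighborhood to which it never returns. -/
theorem exists_ball_of_not_mem_omegaSet {X : Type*} [MetricSpace X] {f : X → X} {x : X}
    (hx : x ∉ omegaSet f x) : ∃ r > 0, ∀ n : ℕ, 1 ≤ n → f^[n] x ∉ ball x r := by
  have hev : ∃ V ∈ 𝓝 x, ∃ N : ℕ, ∀ n ≥ N, f^[n] x ∉ V := by
    by_contra! h
    have hcl : MapClusterPt x atTop (fun n : ℕ => f^[n] x) := by
      rw [mapClusterPt_iff_frequently]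
      intro V hV
      exact frequently_atTop.2 fun N => h V hV N
    obtain ⟨n, hn, hn'⟩ := hcl.tendsto_subseq
    exact hx ⟨n, hn, hn'⟩
  obtain ⟨V, hV, N, hN⟩ := hev
  have hne : ∀ n : ℕ, 1 ≤ n → f^[n] x ≠ x := by
    intro n hn h
    have hper : f^[n * N] x = x := by
      rw [Function.iterate_mul]
      exact Function.iterate_fixed h N
    exact hN (n * N) (Nat.le_mul_of_pos_left N hn) (hper.symm ▸ mem_of_mem_nhds hV)
  have hW : ∀ᶠ y in 𝓝 x, y ∈ V ∧ ∀ n ∈ Finset.Ico 1 N, f^[n] x ≠ y := by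
    refine (show ∀ᶠ y in 𝓝 x, y ∈ V from hV).and ?_
    rw [Filter.eventually_all_finset]
    intro n hn
    exact (eventually_ne_nhds (hne n (Finset.mem_Ico.1 hn).1).symm).mono fun y hy => hy.symm
  obtain ⟨r, hr, hball⟩ := Metric.eventually_nhds_iff_ball.1 hW
  refine ⟨r, hr, fun n hn hmem => ?_⟩
  rcases lt_or_ge n N with h | h
  · exact (hball _ hmem).2 n (Finset.mem_Ico.2 ⟨hn, h⟩) rfl
  · exact hN n h (hball _ hmem).1

/-- For a homeomorphism of a regular curve, the non-wandering set Ω(f) equals the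
set R(f) of recurrent points. -/
theorem nonwandering_eq_recurrent {X : Type*} [MetricSpace X] [Nonempty X]
    [CompactSpace X] [ConnectedSpace X] (hreg : regularCurveAx X) (f : X ≃ₜ X) :
    {x : X | ∀ U : Set X, IsOpen U → x ∈ U →
        ∃ n : ℕ, 1 ≤ n ∧ ((⇑f)^[n] ⁻¹' U ∩ U).Nonempty} =
      {x : X | x ∈ omegaSet (⇑f) x} := by
  ext x
  simp only [mem_ofPred_eq]
  constructor
  · intro hx
    by_contra hrec
    obtain ⟨r, hr, hball⟩ := exists_ball_of_not_mem_omegaSet hrec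
    have hδ : 0 < r / 3 := by positivity
    obtain ⟨F, hF, hmeet⟩ := hreg.exists_finite_meeting hδ
    -- The first entrance times into `closedBall x (r / 3)` of small connected sets around `x`.
    let T : Set ℕ := {n | 1 ≤ n ∧ ∃ C : Set X, IsPreconnected C ∧ x ∈ C ∧
      C ⊆ closedBall x (r / 3) ∧ (∃ y ∈ C, f^[n] y ∈ closedBall x (r / 3)) ∧
      ∀ j, 1 ≤ j → j < n → ∀ y ∈ C, f^[j] y ∉ closedBall x (r / 3)}
    have hT : T.Infinite := by
      refine Set.infinite_of_not_bddAbove ?_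
      rintro ⟨N, hN⟩
      have hev : ∀ᶠ y in 𝓝 x, y ∈ closedBall x (r / 3) ∧
          ∀ j ∈ Finset.Icc 1 N, f^[j] y ∉ closedBall x (r / 3) := by
        refine (show ∀ᶠ y in 𝓝 x, y ∈ closedBall x (r / 3) from closedBall_mem_nhds x hδ).and ?_
        rw [Filter.eventually_all_finset]
        intro j hj
        refine (f.continuous.iterate j).continuousAt.eventually_mem
          (isClosed_closedBall.isOpen_compl.mem_nhds fun h => ?_)
        exact hball j (Finset.mem_Icc.1 hj).1 (closedBall_subset_ball (by linarith) h)
      obtain ⟨C, hC, hCV, hCp⟩ := hreg.exists_preconnected_nhds hev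
      have hex : ∃ n : ℕ, 1 ≤ n ∧ ∃ y ∈ C, f^[n] y ∈ closedBall x (r / 3) := by
        obtain ⟨n, hn, y, hy, hy'⟩ :=
          hx (interior C) isOpen_interior (mem_interior_iff_mem_nhds.2 hC)
        exact ⟨n, hn, y, interior_subset hy', (hCV (interior_subset hy)).1⟩
      classical
      obtain ⟨hn, y, hyC, hy⟩ := Nat.find_spec hex
      have hmem : Nat.find hex ∈ T := by
        refine ⟨hn, C, hCp, mem_of_mem_nhds hC, fun z hz => (hCV hz).1, ⟨y, hyC, hy⟩, ?_⟩
        exact fun j hj hjn z hz hzj => Nat.find_min hex hjn ⟨hj, z, hz, hzj⟩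
      exact (hCV hyC).2 _ (Finset.mem_Icc.2 ⟨hn, hN hmem⟩) hy
    have hpt : ∀ n : T, ∃ z ∈ F, ∃ C : Set X, C ⊆ closedBall x (r / 3) ∧
        (∀ j, 1 ≤ j → j < (n : ℕ) → ∀ y ∈ C, f^[j] y ∉ closedBall x (r / 3)) ∧
        ∃ y ∈ C, f^[(n : ℕ)] y = z := by
      rintro ⟨n, hn, C, hCp, hxC, hCb, ⟨y, hyC, hy⟩, hmin⟩
      obtain ⟨z, ⟨w, hwC, hwz⟩, hzF⟩ := hmeet (f^[n] '' C)
        (hCp.image _ (f.continuous.iterate n).continuousOn) _ (mem_image_of_mem _ hyC) _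
        (mem_image_of_mem _ hxC) (by
          have h1 := mem_closedBall.1 hy
          have h2 : r ≤ dist (f^[n] x) x := not_lt.1 (hball n hn)
          have h3 := dist_triangle (f^[n] x) (f^[n] y) x
          rw [dist_comm (f^[n] x) (f^[n] y)] at h3
          linarith)
      exact ⟨z, hzF, C, hCb, hmin, w, hwC, hwz⟩
    choose z hzF C hCb hmin y hyC hyz using hpt
    have hlt : ∀ k l : T, (k : ℕ) < l → z k ≠ z l := by
      intro k l hkl h
      have hsplit : f^[(l : ℕ)] (y l) = f^[(k : ℕ)] (f^[(l : ℕ) - k] (y l)) := by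
        rw [← Function.iterate_add_apply, Nat.add_sub_cancel' hkl.le]
      have heq : y k = f^[(l : ℕ) - k] (y l) :=
        f.injective.iterate k (by rw [hyz, h, ← hyz l, hsplit])
      have hk : 1 ≤ (k : ℕ) := k.2.1
      exact hmin l (l - k) (by omega) (by omega) (y l) (hyC l) (heq ▸ hCb k (hyC k))
    have hinj : Function.Injective z := by
      intro k l h
      rcases lt_trichotomy (k : ℕ) l with hkl | hkl | hkl
      · exact absurd h (hlt k l hkl)
      · exact Subtype.ext hkl
      · exact absurd h.symm (hlt l k hkl)
    have := hT.to_subtype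
    exact Set.infinite_range_of_injective hinj (hF.subset (range_subset_iff.2 hzF))
  · rintro ⟨n, hn, hlim⟩ U hU hxU
    obtain ⟨i, hi, hi1⟩ :=
      ((hlim.eventually_mem (hU.mem_nhds hxU)).and (eventually_ge_atTop 1)).exists
    exact ⟨n i, hi1.trans (hn.id_le i), x, hi, hxU⟩
end

section
/- Let X be a regular curve, f : X → X a homeomorphism, and (M_n) a sequence of minimal sets of f converging in the Hausdorff metric to a nonempty closed set M. Then M is a minimal set of f. -/
open Set Filter Metric Topology

theorem frontier_biUnion_subset {X ι : Type*} [TopologicalSpace X] {s : Set ι} (hs : s.Finite)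
    (U : ι → Set X) : frontier (⋃ i ∈ s, U i) ⊆ ⋃ i ∈ s, frontier (U i) := by
  intro x hx
  have hcl := frontier_subset_closure hx
  rw [hs.closure_biUnion] at hcl
  obtain ⟨i, hi, hxi⟩ := mem_iUnion₂.1 hcl
  exact mem_iUnion₂.2 ⟨i, hi, hxi, fun h => hx.2 (interior_mono (subset_biUnion_of_mem hi) h)⟩

/-- Closed sets of a regular curve have small open neighborhoods with finite boundary. -/
theorem exists_open_between {X : Type*} [MetricSpace X] [CompactSpace X]
    (hreg : regularCurveAx X) {K O : Set X} (hK : IsClosed K) (hO : IsOpen O) (hKO : K ⊆ O) :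
    ∃ V : Set X, IsOpen V ∧ K ⊆ V ∧ closure V ⊆ O ∧ (frontier V).Finite := by
  obtain ⟨O', hO', hKO', hO'O⟩ := normal_exists_closure_subset hK hO hKO
  choose U hUo hxU hUsub hUfin using fun x : K => hreg x O' hO' (hKO' x.2)
  obtain ⟨t, ht⟩ := hK.isCompact.elim_finite_subcover U hUo
    fun x hx => mem_iUnion.2 ⟨⟨x, hx⟩, hxU _⟩
  refine ⟨⋃ i ∈ t, U i, isOpen_biUnion fun i _ => hUo i, ht, ?_, ?_⟩
  · exact (closure_mono (iUnion₂_subset fun i _ => hUsub i)).trans hO'O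
  · refine (t.finite_toSet.biUnion fun i _ => hUfin i).subset fun x hx => ?_
    exact frontier_biUnion_subset t.finite_toSet U hx

theorem IsPreconnected.inter_frontier_nonempty_of_isOpen {X : Type*} [TopologicalSpace X]
    {C U : Set X}
    (hC : IsPreconnected C) (hCU : (C ∩ U).Nonempty) (hU : IsOpen U) (h : ¬ C ⊆ U) :
    (C ∩ frontier U).Nonempty := by
  by_contra hne
  apply h
  refine hC.subset_left_of_subset_union hU (v := (closure U)ᶜ) isClosed_closure.isOpen_compl
    (disjoint_compl_right.mono_left subset_closure) ?_ hCU
  intro x hx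
  by_cases hxU : x ∈ U
  · exact Or.inl hxU
  · refine Or.inr fun hcl => hne ⟨x, hx, ?_⟩
    rw [hU.frontier_eq]
    exact ⟨hcl, hxU⟩

/-- A regular curve is locally connected. -/
theorem regularCurveAx.locallyConnectedSpace {X : Type*} [MetricSpace X] [CompactSpace X]
    [ConnectedSpace X] (hreg : regularCurveAx X) : LocallyConnectedSpace X := by
  rw [locallyConnectedSpace_iff_connected_subsets]
  intro x V hV
  obtain ⟨U, hUo, hxU, hUV, hUfin⟩ := exists_open_between hreg (K := {x}) isClosed_singleton
    isOpen_interior (singleton_subset_iff.2 (mem_interior_iff_mem_nhds.2 hV))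
  rw [singleton_subset_iff] at hxU
  let Y := closure U
  have : CompactSpace Y := isCompact_iff_compactSpace.1 isClosed_closure.isCompact
  let x' : Y := ⟨x, subset_closure hxU⟩
  let K : Set Y := connectedComponent x'
  have hsep : ∀ w : Y, w ∉ K → ∃ E : Set Y, IsClopen E ∧ x' ∈ E ∧ w ∉ E := by
    intro w hw
    have : w ∉ ⋂ s : { s : Set Y // IsClopen s ∧ x' ∈ s }, (s : Set Y) := by
      rwa [← connectedComponent_eq_iInter_isClopen]
    rw [mem_iInter] at this
    push Not at this
    obtain ⟨s, hs⟩ := this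
    exact ⟨s, s.2.1, s.2.2, hs⟩
  have hfin : {w : Y | (w : X) ∈ frontier U ∧ w ∉ K}.Finite :=
    (hUfin.preimage (Subtype.val_injective.injOn)).subset fun w hw => hw.1
  choose! E hE hxE hwE using hsep
  let D : Set Y := ⋂ w ∈ {w : Y | (w : X) ∈ frontier U ∧ w ∉ K}, E w
  have hD : IsClopen D := hfin.isClopen_biInter fun w hw => hE w hw.2
  have hKD : K ⊆ D := hD.connectedComponent_subset (mem_iInter₂.2 fun w hw => hxE w hw.2)
  have hDK : D ⊆ K := by
    intro w hw
    by_contra hwK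
    have hclo : IsClopen (D \ E w) := hD.diff (hE w hwK)
    have hDf : ∀ v ∈ D \ E w, (v : X) ∈ U := by
      intro v hv
      by_contra hvU
      have hvf : (v : X) ∈ frontier U := by
        rw [hUo.frontier_eq]; exact ⟨v.2, hvU⟩
      by_cases hvK : v ∈ K
      · exact hv.2 ((hE w hwK).connectedComponent_subset (hxE w hwK) hvK)
      · exact hwE v hvK (mem_iInter₂.1 hv.1 v ⟨hvf, hvK⟩)
    have hclX : IsClosed (Subtype.val '' (D \ E w)) :=
      isClosed_closure.isClosedEmbedding_subtypeVal.isClosedMap _ hclo.1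
    have hopX : IsOpen (Subtype.val '' (D \ E w)) := by
      obtain ⟨O, hO, hOE⟩ := isOpen_induced_iff.1 hclo.2
      have : Subtype.val '' (D \ E w) = O ∩ U := by
        ext z
        constructor
        · rintro ⟨v, hv, rfl⟩
          exact ⟨by rw [← hOE] at hv; exact hv, hDf v hv⟩
        · rintro ⟨hzO, hzU⟩
          exact ⟨⟨z, subset_closure hzU⟩, by rw [← hOE]; exact hzO, rfl⟩
      rw [this]
      exact hO.inter hUo
    have huniv := IsClopen.eq_univ ⟨hclX, hopX⟩ ⟨w, w, ⟨hw, hwE w hwK⟩, rfl⟩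
    obtain ⟨v, hv, hvx⟩ : x ∈ Subtype.val '' (D \ E w) := huniv ▸ mem_univ x
    have : v = x' := Subtype.ext hvx
    exact hv.2 (this ▸ hxE w hwK)
  have hKop : IsOpen K := (hKD.antisymm hDK) ▸ hD.2
  refine ⟨Subtype.val '' K, ?_, ?_, ?_⟩
  · obtain ⟨O, hO, hOK⟩ := isOpen_induced_iff.1 hKop
    have hxO : x ∈ O := by
      have : x' ∈ K := mem_connectedComponent
      rw [← hOK] at this; exact this
    filter_upwards [hO.mem_nhds hxO, hUo.mem_nhds hxU] with z hzO hzU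
    exact ⟨⟨z, subset_closure hzU⟩, by rw [← hOK]; exact hzO, rfl⟩
  · exact isPreconnected_connectedComponent.image _ continuous_subtype_val.continuousOn
  · rintro _ ⟨v, -, rfl⟩
    exact interior_subset (hUV v.2)

/-- Some finite set meets every connected subset of diameter greater than `ε`. -/
theorem regularCurveAx.exists_finite_net {X : Type*} [MetricSpace X] [CompactSpace X]
    (hreg : regularCurveAx X) {ε : ℝ} (hε : 0 < ε) :
    ∃ F : Set X, F.Finite ∧ ∀ C : Set X, IsPreconnected C → Disjoint C F →
      ∀ a ∈ C, ∀ b ∈ C, dist a b ≤ ε := by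
  choose U hUo hxU hUsub hUfin using
    fun x : X => hreg x (ball x (ε / 2)) isOpen_ball (mem_ball_self (by positivity))
  obtain ⟨t, ht⟩ := isCompact_univ.elim_finite_subcover U hUo
    fun x _ => mem_iUnion.2 ⟨x, hxU x⟩
  refine ⟨⋃ i ∈ t, frontier (U i), t.finite_toSet.biUnion fun i _ => hUfin i, ?_⟩
  intro C hC hdis a ha b hb
  obtain ⟨i, hi, hai⟩ := mem_iUnion₂.1 (ht (mem_univ a))
  have hsub : C ⊆ U i := by
    by_contra hns
    obtain ⟨z, hzC, hz⟩ := hC.inter_frontier_nonempty_of_isOpen ⟨a, ha, hai⟩ (hUo i) hns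
    exact disjoint_left.1 hdis hzC (mem_iUnion₂.2 ⟨i, hi, hz⟩)
  have h1 := mem_ball.1 (hUsub i hai)
  have h2 := mem_ball.1 (hUsub i (hsub hb))
  linarith [dist_triangle_right a b i]

/-- An open set `W` containing the members of `G₁`, avoiding those of `G₂`, and with finitely many
boundary points in `X₀`. -/
structure IsCut {X : Type*} [TopologicalSpace X] (G₁ G₂ : Filter X) (X₀ W : Set X) : Prop where
  isOpen : IsOpen W
  finite : (frontier W ∩ X₀).Finite
  mem : W ∈ G₁
  compl_mem : Wᶜ ∈ G₂

/-- A cut with the least possible number of boundary points in `X₀`. -/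
structure IsMinCut {X : Type*} [TopologicalSpace X] (G₁ G₂ : Filter X) (X₀ W : Set X) : Prop
    extends IsCut G₁ G₂ X₀ W where
  le : ∀ W', IsCut G₁ G₂ X₀ W' → (frontier W ∩ X₀).ncard ≤ (frontier W' ∩ X₀).ncard

theorem IsCut.exists_isMinCut {X : Type*} [TopologicalSpace X] {G₁ G₂ : Filter X} {X₀ W : Set X}
    (hW : IsCut G₁ G₂ X₀ W) : ∃ W', IsMinCut G₁ G₂ X₀ W' := by
  classical
  have h : ∃ k, ∃ W, IsCut G₁ G₂ X₀ W ∧ (frontier W ∩ X₀).ncard = k := ⟨_, W, hW, rfl⟩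
  obtain ⟨W', hW', hk⟩ := Nat.find_spec h
  exact ⟨W', hW', fun V hV => hk ▸ Nat.find_min' h ⟨V, hV, rfl⟩⟩

theorem ncard_frontier_union_add_inter_le {X : Type*} [TopologicalSpace X] {A B X₀ : Set X}
    (hA : IsOpen A) (hB : IsOpen B) (hAf : (frontier A ∩ X₀).Finite)
    (hBf : (frontier B ∩ X₀).Finite) :
    (frontier (A ∪ B) ∩ X₀).ncard + (frontier (A ∩ B) ∩ X₀).ncard ≤
      (frontier A ∩ X₀).ncard + (frontier B ∩ X₀).ncard := by
  have hU : frontier (A ∪ B) ⊆ frontier A ∪ frontier B :=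
    (frontier_union_subset A B).trans (union_subset_union inter_subset_left inter_subset_right)
  have hI : frontier (A ∩ B) ⊆ frontier A ∪ frontier B :=
    (frontier_inter_subset A B).trans (union_subset_union inter_subset_left inter_subset_right)
  have hUI : frontier (A ∪ B) ∩ frontier (A ∩ B) ⊆ frontier A ∩ frontier B := by
    rintro x ⟨hx, hx'⟩
    rw [(hA.union hB).frontier_eq] at hx
    have hcl := closure_inter_subset_inter_closure _ _ (frontier_subset_closure hx')
    rw [hA.frontier_eq, hB.frontier_eq]
    exact ⟨⟨hcl.1, fun h => hx.2 (Or.inl h)⟩, ⟨hcl.2, fun h => hx.2 (Or.inr h)⟩⟩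
  have hf := hAf.union hBf
  have hUf : (frontier (A ∪ B) ∩ X₀).Finite := hf.subset fun x hx => by
    rw [← union_inter_distrib_right]; exact ⟨hU hx.1, hx.2⟩
  have hIf : (frontier (A ∩ B) ∩ X₀).Finite := hf.subset fun x hx => by
    rw [← union_inter_distrib_right]; exact ⟨hI hx.1, hx.2⟩
  rw [← ncard_union_add_ncard_inter _ _ hUf hIf, ← ncard_union_add_ncard_inter _ _ hAf hBf]
  refine Nat.add_le_add (ncard_le_ncard ?_ hf) (ncard_le_ncard ?_ (hAf.inter_of_left _))
  · rw [← union_inter_distrib_right, ← union_inter_distrib_right]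
    exact inter_subset_inter_left _ (union_subset hU hI)
  · rintro x ⟨⟨hx, h0⟩, hx', -⟩
    exact ⟨⟨(hUI ⟨hx, hx'⟩).1, h0⟩, (hUI ⟨hx, hx'⟩).2, h0⟩

theorem IsCut.union {X : Type*} [TopologicalSpace X] {G₁ G₂ : Filter X} {X₀ A B : Set X}
    (hA : IsCut G₁ G₂ X₀ A) (hB : IsCut G₁ G₂ X₀ B) : IsCut G₁ G₂ X₀ (A ∪ B) where
  isOpen := hA.isOpen.union hB.isOpen
  finite := (hA.finite.union hB.finite).subset fun x hx => by
    rw [← union_inter_distrib_right]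
    exact ⟨((frontier_union_subset A B).trans
      (union_subset_union inter_subset_left inter_subset_right)) hx.1, hx.2⟩
  mem := mem_of_superset hA.mem subset_union_left
  compl_mem := by rw [compl_union]; exact inter_mem hA.compl_mem hB.compl_mem

theorem IsCut.inter {X : Type*} [TopologicalSpace X] {G₁ G₂ : Filter X} {X₀ A B : Set X}
    (hA : IsCut G₁ G₂ X₀ A) (hB : IsCut G₁ G₂ X₀ B) : IsCut G₁ G₂ X₀ (A ∩ B) where
  isOpen := hA.isOpen.inter hB.isOpen
  finite := (hA.finite.union hB.finite).subset fun x hx => by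
    rw [← union_inter_distrib_right]
    exact ⟨((frontier_inter_subset A B).trans
      (union_subset_union inter_subset_left inter_subset_right)) hx.1, hx.2⟩
  mem := inter_mem hA.mem hB.mem
  compl_mem := by rw [compl_inter]; exact mem_of_superset hA.compl_mem subset_union_left

theorem Homeomorph.frontier_preimage_inter {X : Type*} [TopologicalSpace X] (g : X ≃ₜ X)
    {X₀ : Set X} (h0 : g ⁻¹' X₀ = X₀) (W : Set X) :
    frontier (g ⁻¹' W) ∩ X₀ = g ⁻¹' (frontier W ∩ X₀) := by
  rw [preimage_inter, h0, g.preimage_frontier]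

theorem IsCut.preimage {X : Type*} [TopologicalSpace X] {G₁ G₂ : Filter X} {X₀ W : Set X}
    (hW : IsCut G₁ G₂ X₀ W) (g : X ≃ₜ X) (h0 : g ⁻¹' X₀ = X₀) (h₁ : Tendsto g G₁ G₁)
    (h₂ : Tendsto g G₂ G₂) : IsCut G₁ G₂ X₀ (g ⁻¹' W) where
  isOpen := hW.isOpen.preimage g.continuous
  finite := by
    rw [g.frontier_preimage_inter h0]
    exact hW.finite.preimage g.injective.injOn
  mem := h₁ hW.mem
  compl_mem := h₂ hW.compl_mem

theorem Homeomorph.pow_preimage_eq {X : Type*} [TopologicalSpace X] {g : X ≃ₜ X}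
    {X₀ : Set X} (h0 : g ⁻¹' X₀ = X₀) (n : ℕ) : (g ^ n) ⁻¹' X₀ = X₀ := by
  induction n with
  | zero => rfl
  | succ n ih =>
    rw [pow_succ]
    change g ⁻¹' ((g ^ n) ⁻¹' X₀) = X₀
    rw [ih, h0]

theorem Homeomorph.inv_preimage_eq {X : Type*} [TopologicalSpace X] {g : X ≃ₜ X} {N : Set X}
    (h : g ⁻¹' N = N) : (g⁻¹ : X ≃ₜ X) ⁻¹' N = N := by
  conv_lhs => rw [← h]
  ext x
  simp

theorem Homeomorph.tendsto_pow {X : Type*} [TopologicalSpace X] {g : X ≃ₜ X}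
    {G : Filter X} (h : Tendsto g G G) (n : ℕ) : Tendsto (g ^ n) G G := by
  induction n with
  | zero => exact tendsto_id
  | succ n ih => rw [pow_succ]; exact ih.comp h

/-- The points entering `W` within `n` iterations of `g`. -/
def entrySet {X : Type*} [TopologicalSpace X] (g : X ≃ₜ X) (W : Set X) (n : ℕ) : Set X :=
  ⋃ i ∈ Iic n, (g ^ i) ⁻¹' W

theorem mem_entrySet {X : Type*} [TopologicalSpace X] {g : X ≃ₜ X} {W : Set X} {n : ℕ} {x : X} :
    x ∈ entrySet g W n ↔ ∃ i ≤ n, (g ^ i) x ∈ W := by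
  simp [entrySet]

theorem entrySet_succ {X : Type*} [TopologicalSpace X] (g : X ≃ₜ X) (W : Set X) (n : ℕ) :
    entrySet g W (n + 1) = entrySet g W n ∪ (g ^ (n + 1)) ⁻¹' W := by
  ext x
  simp only [mem_entrySet, mem_union, mem_preimage, Nat.le_succ_iff]
  constructor
  · rintro ⟨i, hi | rfl, h⟩
    exacts [Or.inl ⟨i, hi, h⟩, Or.inr h]
  · rintro (⟨i, hi, h⟩ | h)
    exacts [⟨i, Or.inl hi, h⟩, ⟨_, Or.inr rfl, h⟩]

/-- By submodularity of the number of boundary points, the entry sets of a minimal cut are again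
cuts with the least possible number of boundary points. -/
theorem IsMinCut.isCut_entrySet {X : Type*} [TopologicalSpace X] {G₁ G₂ : Filter X} {X₀ W : Set X}
    (hW : IsMinCut G₁ G₂ X₀ W) {g : X ≃ₜ X} (h0 : g ⁻¹' X₀ = X₀) (h₁ : Tendsto g G₁ G₁)
    (h₂ : Tendsto g G₂ G₂) (n : ℕ) :
    IsCut G₁ G₂ X₀ (entrySet g W n) ∧
      (frontier (entrySet g W n) ∩ X₀).ncard = (frontier W ∩ X₀).ncard := by
  induction n with
  | zero =>
    have : entrySet g W 0 = W := by ext x; simp [mem_entrySet]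
    rw [this]
    exact ⟨hW.toIsCut, rfl⟩
  | succ n ih =>
    rw [entrySet_succ]
    have h0' := Homeomorph.pow_preimage_eq h0 (n + 1)
    have hp : IsCut G₁ G₂ X₀ ((g ^ (n + 1)) ⁻¹' W) :=
      hW.toIsCut.preimage _ h0' (Homeomorph.tendsto_pow h₁ _) (Homeomorph.tendsto_pow h₂ _)
    have hpc : (frontier ((g ^ (n + 1)) ⁻¹' W) ∩ X₀).ncard = (frontier W ∩ X₀).ncard := by
      rw [Homeomorph.frontier_preimage_inter _ h0']
      exact ncard_preimage_of_injective_subset_range (g ^ (n + 1)).injective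
        (by rw [(g ^ (n + 1)).surjective.range_eq]; exact subset_univ _)
    refine ⟨ih.1.union hp, ?_⟩
    have hsub := ncard_frontier_union_add_inter_le ih.1.isOpen hp.isOpen ih.1.finite hp.finite
    have hU := hW.le _ (ih.1.union hp)
    have hI := hW.le _ (ih.1.inter hp)
    rw [ih.2, hpc] at hsub
    omega

theorem eventually_frontier_entrySet_inter_nonempty {X : Type*} [TopologicalSpace X]
    [LocallyConnectedSpace X] {g : X ≃ₜ X} {W : Set X} (hW : IsOpen W) {q : X}
    (hq : q ∈ frontier (⋃ n, entrySet g W n)) {O : Set X} (hO : O ∈ 𝓝 q) :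
    ∀ᶠ n in atTop, (O ∩ frontier (entrySet g W n)).Nonempty := by
  have hop : ∀ n, IsOpen (entrySet g W n) := fun n =>
    isOpen_biUnion fun i _ => hW.preimage (g ^ i).continuous
  obtain ⟨C, hC, hCc, hCO⟩ := locallyConnectedSpace_iff_connected_subsets.1 ‹_› q O hO
  rw [(isOpen_iUnion hop).frontier_eq] at hq
  obtain ⟨z, hzC, hz⟩ := mem_closure_iff_nhds.1 hq.1 C hC
  obtain ⟨m, hm⟩ := mem_iUnion.1 hz
  filter_upwards [eventually_ge_atTop m] with n hn
  obtain ⟨i, hi, hiW⟩ := mem_entrySet.1 hm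
  obtain ⟨w, hwC, hw⟩ := hCc.inter_frontier_nonempty_of_isOpen
    ⟨z, hzC, mem_entrySet.2 ⟨i, hi.trans hn, hiW⟩⟩ (hop n)
    (fun h => hq.2 (mem_iUnion.2 ⟨n, h (mem_of_mem_nhds hC)⟩))
  exact ⟨w, hCO hwC, hw⟩

/-- The set of points whose forward orbit ever enters a minimal cut is clopen in `X₀`. -/
theorem IsMinCut.frontier_iUnion_entrySet_inter_eq_empty {X : Type*} [MetricSpace X]
    [CompactSpace X] [LocallyConnectedSpace X] (hreg : regularCurveAx X) {N₁ N₂ X₀ W : Set X}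
    {Z : Filter X} (hN₁ : IsClosed N₁) (hN₂ : IsClosed N₂) (hd : Disjoint N₁ N₂)
    (hX₀ : X₀ = (N₁ ∪ N₂)ᶜ) {g : X ≃ₜ X} (hg₁ : g ⁻¹' N₁ = N₁) (hg₂ : g ⁻¹' N₂ = N₂)
    (hZ₀ : X₀ ∈ Z) (hZ : Tendsto g Z Z)
    (htrap : ∀ W', g ⁻¹' W' ⊆ W' → (∃ᶠ x in Z, x ∈ W') → W' ∈ Z)
    [(𝓝ˢ N₁ ⊓ Z).NeBot] (hW : IsMinCut (𝓝ˢ N₁ ⊓ Z) (𝓝ˢ N₂ ⊓ Z) X₀ W) :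
    frontier (⋃ n, entrySet g W n) ∩ X₀ = ∅ := by
  have h0 : g ⁻¹' X₀ = X₀ := by rw [hX₀, preimage_compl, preimage_union, hg₁, hg₂]
  have hX₀o : IsOpen X₀ := hX₀ ▸ (hN₁.union hN₂).isOpen_compl
  have hcut := hW.isCut_entrySet h0
    ((g.continuous.tendsto_nhdsSet fun x hx => (hg₁.symm ▸ hx : x ∈ g ⁻¹' N₁)).inf hZ)
    ((g.continuous.tendsto_nhdsSet fun x hx => (hg₂.symm ▸ hx : x ∈ g ⁻¹' N₂)).inf hZ)
  set Wp := ⋃ n, entrySet g W n with hWp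
  have hop : ∀ n, IsOpen (entrySet g W n) := fun n => (hcut n).1.isOpen
  have hWpo : IsOpen Wp := isOpen_iUnion hop
  have hWpZ : Wp ∈ Z := by
    refine htrap _ (fun x hx => ?_) ?_
    · obtain ⟨n, hn⟩ := mem_iUnion.1 hx
      obtain ⟨i, hi, hx'⟩ := mem_entrySet.1 hn
      exact mem_iUnion.2 ⟨n + 1, mem_entrySet.2 ⟨i + 1, by omega, by rw [pow_succ]; exact hx'⟩⟩
    · have h₁ : ∀ᶠ x in 𝓝ˢ N₁ ⊓ Z, x ∈ Wp := mem_of_superset hW.mem fun x hx =>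
        mem_iUnion.2 ⟨0, mem_entrySet.2 ⟨0, le_rfl, hx⟩⟩
      exact h₁.frequently.filter_mono inf_le_right
  have hQ : (frontier Wp ∩ X₀).Finite := by
    by_contra hinf
    obtain ⟨T, hTQ, hTf, hTc⟩ := Set.Infinite.exists_subset_ncard_eq hinf
      ((frontier W ∩ X₀).ncard + 1)
    obtain ⟨U, hU, hUd⟩ := hTf.t2_separation
    have hev : ∀ᶠ n in atTop, ∀ q ∈ T, (U q ∩ X₀ ∩ frontier (entrySet g W n)).Nonempty :=
      (eventually_all_finite hTf).2 fun q hq => eventually_frontier_entrySet_inter_nonempty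
        hW.isOpen (hTQ hq).1 (((hU q).2.inter hX₀o).mem_nhds ⟨(hU q).1, (hTQ hq).2⟩)
    obtain ⟨n, hn⟩ := hev.exists
    choose! p hp using hn
    have hle : T.ncard ≤ (frontier (entrySet g W n) ∩ X₀).ncard :=
      ncard_le_ncard_of_injOn p (fun q hq => ⟨(hp q hq).2, (hp q hq).1.2⟩)
        (fun a ha b hb hab => by
          by_contra hne
          exact disjoint_left.1 (hUd ha hb hne) (hp a ha).1.1 (hab ▸ (hp b hb).1.1))
        (hcut n).1.finite
    rw [(hcut n).2] at hle
    omega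
  by_contra hne
  obtain ⟨q, hq⟩ := nonempty_iff_ne_empty.2 hne
  obtain ⟨V, hVo, hNV, hVQ, hVf⟩ := exists_open_between hreg (K := N₂)
    (O := (frontier Wp ∩ X₀ ∪ N₁)ᶜ) hN₂ (hQ.isClosed.union hN₁).isOpen_compl (by
      rintro x hx (⟨-, h⟩ | h)
      · rw [hX₀] at h; exact h (Or.inr hx)
      · exact disjoint_left.1 hd h hx)
  have hlarge : ∀ᶠ n in atTop, ∀ a ∈ frontier V ∩ Wp, a ∈ entrySet g W n :=
    (eventually_all_finite (hVf.inter_of_left _)).2 fun a ha => by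
      obtain ⟨m, hm⟩ := mem_iUnion.1 ha.2
      obtain ⟨i, hi, h⟩ := mem_entrySet.1 hm
      filter_upwards [eventually_ge_atTop m] with n hn
      exact mem_entrySet.2 ⟨i, hi.trans hn, h⟩
  have hout := eventually_frontier_entrySet_inter_nonempty hW.isOpen hq.1
    ((isClosed_closure.isOpen_compl.inter hX₀o).mem_nhds
      ⟨fun h => hVQ h (Or.inl hq), hq.2⟩ : (closure V)ᶜ ∩ X₀ ∈ 𝓝 q)
  obtain ⟨n, hn, r, ⟨hrV, hr₀⟩, hr⟩ := (hlarge.and hout).exists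
  set E := entrySet g W n
  set Y := (V ∩ Wp) \ E with hY
  have hYcl : closure Y ∩ X₀ ⊆ Y := by
    rintro a ⟨ha, ha₀⟩
    have haV : a ∈ closure V := closure_mono (fun x hx => hx.1.1) ha
    have haE : a ∉ E :=
      closure_minimal (fun x hx => hx.2) (hop n).isClosed_compl ha
    have haW : a ∈ Wp := by
      by_contra h
      refine hVQ haV (Or.inl ⟨?_, ha₀⟩)
      rw [hWpo.frontier_eq]
      exact ⟨closure_mono (fun x hx => hx.1.2) ha, h⟩
    refine ⟨⟨?_, haW⟩, haE⟩
    by_contra h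
    exact haE (hn a ⟨by rw [hVo.frontier_eq]; exact ⟨haV, h⟩, haW⟩)
  have hW'o : IsOpen (X₀ \ closure Y) := hX₀o.sdiff isClosed_closure
  have hfr : frontier (X₀ \ closure Y) ∩ X₀ ⊆ frontier E ∩ X₀ ∩ V := by
    rintro a ⟨ha, ha₀⟩
    rw [hW'o.frontier_eq] at ha
    have haY : a ∈ Y := hYcl ⟨by_contra fun h => ha.2 ⟨ha₀, h⟩, ha₀⟩
    refine ⟨⟨?_, ha₀⟩, haY.1.1⟩
    rw [(hop n).frontier_eq]
    refine ⟨?_, haY.2⟩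
    have := (hVo.inter hWpo).inter_closure ⟨haY.1, ha.1⟩
    exact closure_mono (fun b hb => by_contra fun h => hb.2.2 (subset_closure ⟨hb.1, h⟩)) this
  have hlt : (frontier (X₀ \ closure Y) ∩ X₀).ncard < (frontier E ∩ X₀).ncard :=
    ncard_lt_ncard (ssubset_iff_of_subset (hfr.trans inter_subset_left) |>.2
      ⟨r, ⟨hr, hr₀⟩, fun h => hrV (subset_closure (hfr h).2)⟩) (hcut n).1.finite
  have hle := hW.le (X₀ \ closure Y)
    { isOpen := hW'o
      finite := (hcut n).1.finite.subset (hfr.trans inter_subset_left)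
      mem := by
        have h₁ : (closure V)ᶜ ∈ 𝓝ˢ N₁ := isClosed_closure.isOpen_compl.mem_nhdsSet.2
          fun x hx h => hVQ h (Or.inr hx)
        filter_upwards [mem_inf_of_left h₁, mem_inf_of_right hZ₀] with x hx hx₀
        exact ⟨hx₀, fun h => hx (closure_mono (fun y hy => hy.1.1) h)⟩
      compl_mem := by
        filter_upwards [mem_inf_of_left (hVo.mem_nhdsSet.2 hNV), mem_inf_of_right hWpZ,
          (hcut n).1.compl_mem] with x hxV hxW hxE h
        exact h.2 (subset_closure ⟨⟨hxV, hxW⟩, hxE⟩) }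
  rw [(hcut n).2] at hlt
  omega

/-- A minimal cut is clopen in `X₀`. -/
theorem IsMinCut.frontier_inter_eq_empty {X : Type*} [MetricSpace X]
    [CompactSpace X] [LocallyConnectedSpace X] (hreg : regularCurveAx X) {N₁ N₂ X₀ W : Set X}
    {Z : Filter X} (hN₁ : IsClosed N₁) (hN₂ : IsClosed N₂) (hd : Disjoint N₁ N₂)
    (hX₀ : X₀ = (N₁ ∪ N₂)ᶜ) {f : X ≃ₜ X} (hf₁ : f ⁻¹' N₁ = N₁) (hf₂ : f ⁻¹' N₂ = N₂)
    (hZ₀ : X₀ ∈ Z) (hZ : Tendsto f Z Z) (hZ' : Tendsto (f⁻¹ : X ≃ₜ X) Z Z)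
    (htrap : ∀ W', f ⁻¹' W' ⊆ W' → (∃ᶠ x in Z, x ∈ W') → W' ∈ Z)
    (htrap' : ∀ W', (f⁻¹ : X ≃ₜ X) ⁻¹' W' ⊆ W' → (∃ᶠ x in Z, x ∈ W') → W' ∈ Z)
    [(𝓝ˢ N₁ ⊓ Z).NeBot] (hW : IsMinCut (𝓝ˢ N₁ ⊓ Z) (𝓝ˢ N₂ ⊓ Z) X₀ W) :
    frontier W ∩ X₀ = ∅ := by
  have h0 : f ⁻¹' X₀ = X₀ := by rw [hX₀, preimage_compl, preimage_union, hf₁, hf₂]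
  have hsat := hW.frontier_iUnion_entrySet_inter_eq_empty hreg hN₁ hN₂ hd hX₀ hf₁ hf₂ hZ₀ hZ htrap
  have hsat' := hW.frontier_iUnion_entrySet_inter_eq_empty hreg hN₁ hN₂ hd hX₀
    (Homeomorph.inv_preimage_eq hf₁) (Homeomorph.inv_preimage_eq hf₂) hZ₀ hZ' htrap'
  have hcut := hW.isCut_entrySet h0
    ((f.continuous.tendsto_nhdsSet fun x hx => (hf₁.symm ▸ hx : x ∈ f ⁻¹' N₁)).inf hZ)
    ((f.continuous.tendsto_nhdsSet fun x hx => (hf₂.symm ▸ hx : x ∈ f ⁻¹' N₂)).inf hZ)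
  have hmem : ∀ g : X ≃ₜ X, frontier (⋃ n, entrySet g W n) ∩ X₀ = ∅ →
      ∀ᶠ n in atTop, ∀ a ∈ frontier W ∩ X₀, a ∈ entrySet g W n := by
    intro g hg
    have hop : IsOpen (⋃ n, entrySet g W n) := isOpen_iUnion fun n =>
      isOpen_biUnion fun i _ => hW.isOpen.preimage (g ^ i).continuous
    refine (eventually_all_finite hW.finite).2 fun a ha => ?_
    have haU : a ∈ ⋃ n, entrySet g W n := by
      by_contra h
      refine (hg ▸ ⟨?_, ha.2⟩ : a ∈ (∅ : Set X))
      rw [hop.frontier_eq]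
      exact ⟨closure_mono (fun x hx => mem_iUnion.2 ⟨0, mem_entrySet.2 ⟨0, le_rfl, hx⟩⟩)
        (frontier_subset_closure ha.1), h⟩
    obtain ⟨m, hm⟩ := mem_iUnion.1 haU
    obtain ⟨i, hi, h⟩ := mem_entrySet.1 hm
    filter_upwards [eventually_ge_atTop m] with n hn
    exact mem_entrySet.2 ⟨i, hi.trans hn, h⟩
  obtain ⟨n, hn, hn'⟩ := ((hmem f hsat).and (hmem f⁻¹ hsat')).exists
  have hempty : frontier (entrySet f W (2 * n)) ∩ X₀ = ∅ := by
    rw [eq_empty_iff_forall_notMem]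
    rintro b ⟨hb, hb₀⟩
    have hbE : b ∉ entrySet f W (2 * n) := by
      rw [(hcut (2 * n)).1.isOpen.frontier_eq] at hb
      exact hb.2
    obtain ⟨i, hi, hbi⟩ := mem_iUnion₂.1 (frontier_biUnion_subset (finite_Iic _) _ hb)
    rw [← (f ^ i).preimage_frontier] at hbi
    have ha : (f ^ i) b ∈ frontier W ∩ X₀ :=
      ⟨hbi, ((Homeomorph.pow_preimage_eq h0 i).symm ▸ hb₀ : b ∈ (f ^ i) ⁻¹' X₀)⟩
    rcases le_or_gt i n with hin | hin
    · obtain ⟨s, hs, h⟩ := mem_entrySet.1 (hn _ ha)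
      exact hbE (mem_entrySet.2 ⟨s + i, by omega, by rw [pow_add]; exact h⟩)
    · obtain ⟨s, hs, h⟩ := mem_entrySet.1 (hn' _ ha)
      rw [← Homeomorph.mul_apply] at h
      have : f⁻¹ ^ s * f ^ i = f ^ (i - s) := by
        rw [inv_pow, inv_mul_eq_iff_eq_mul, ← pow_add, Nat.add_sub_cancel' (by omega)]
      rw [this] at h
      exact hbE (mem_entrySet.2 ⟨i - s, (Nat.sub_le _ _).trans hi, h⟩)
  rw [← ncard_eq_zero hW.finite, ← (hcut (2 * n)).2, hempty, ncard_empty]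

/-- In a regular curve, an orbit of a homeomorphism cannot accumulate at two disjoint closed
invariant sets. -/
theorem regularCurveAx.not_mapClusterPt_of_disjoint {X : Type*} [MetricSpace X] [CompactSpace X]
    [ConnectedSpace X] (hreg : regularCurveAx X) (f : X ≃ₜ X) {c x₁ x₂ : X} {N₁ N₂ : Set X}
    (hN₁ : IsClosed N₁) (hN₂ : IsClosed N₂) (hd : Disjoint N₁ N₂) (hf₁ : f ⁻¹' N₁ = N₁)
    (hf₂ : f ⁻¹' N₂ = N₂) (hx₁ : x₁ ∈ N₁) (hx₂ : x₂ ∈ N₂)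
    (hc₁ : MapClusterPt x₁ atTop fun n : ℕ => (f ^ n) c) :
    ¬ MapClusterPt x₂ atTop fun n : ℕ => (f ^ n) c := by
  intro hc₂
  have := hreg.locallyConnectedSpace
  set z : ℕ → X := fun n => (f ^ n) c with hz
  have hzadd : ∀ i n, z (i + n) = (f ^ i) (z n) := fun i n => by
    simp only [hz, pow_add]; rfl
  have hzs : ∀ n, z (n + 1) = f (z n) := fun n => by rw [add_comm, hzadd, pow_one]
  set X₀ := (N₁ ∪ N₂)ᶜ with hX₀
  have h0 : f ⁻¹' X₀ = X₀ := by rw [hX₀, preimage_compl, preimage_union, hf₁, hf₂]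
  have hX₀o : IsOpen X₀ := (hN₁.union hN₂).isOpen_compl
  have hnot : ∀ {N N' : Set X} {x : X}, IsClosed N → f ⁻¹' N = N → Disjoint N N' → x ∈ N' →
      MapClusterPt x atTop z → c ∉ N := by
    intro N N' x hN hfN hdis hx hcl hc
    have : ∀ n, z n ∈ N := fun n =>
      ((Homeomorph.pow_preimage_eq hfN n).symm ▸ hc : c ∈ (f ^ n) ⁻¹' N)
    obtain ⟨n, hn⟩ := (hcl.frequently (hN.isOpen_compl.mem_nhds (disjoint_right.1 hdis hx))).exists
    exact hn (this n)
  have hzX₀ : ∀ n, z n ∈ X₀ := fun n =>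
    ((Homeomorph.pow_preimage_eq h0 n).symm ▸ (fun h => h.elim (hnot hN₁ hf₁ hd hx₂ hc₂)
      (hnot hN₂ hf₂ hd.symm hx₁ hc₁)) : c ∈ (f ^ n) ⁻¹' X₀)
  have hG₁ : (𝓝ˢ N₁ ⊓ map z atTop).NeBot :=
    NeBot.mono hc₁ (inf_le_inf_right _ (nhds_le_nhdsSet hx₁))
  have hG₂ : (𝓝ˢ N₂ ⊓ map z atTop).NeBot :=
    NeBot.mono hc₂ (inf_le_inf_right _ (nhds_le_nhdsSet hx₂))
  obtain ⟨V, hVo, hNV, hVN, hVf⟩ := exists_open_between hreg hN₁ hN₂.isOpen_compl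
    (disjoint_left.1 hd)
  obtain ⟨W, hW⟩ := IsCut.exists_isMinCut (G₁ := 𝓝ˢ N₁ ⊓ map z atTop)
    (G₂ := 𝓝ˢ N₂ ⊓ map z atTop) (X₀ := X₀) (W := V)
    { isOpen := hVo
      finite := hVf.inter_of_left _
      mem := mem_inf_of_left (hVo.mem_nhdsSet.2 hNV)
      compl_mem := mem_inf_of_left (mem_of_superset
        (isClosed_closure.isOpen_compl.mem_nhdsSet.2 fun x hx h => hVN h hx)
        (compl_subset_compl.2 subset_closure)) }
  have hWfr : frontier W ∩ X₀ = ∅ := by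
    refine hW.frontier_inter_eq_empty hreg hN₁ hN₂ hd hX₀ hf₁ hf₂
      (mem_map.2 (Eventually.of_forall hzX₀)) ?_ ?_ ?_ ?_
    · rw [tendsto_map'_iff]
      have : f ∘ z = z ∘ (· + 1) := funext fun n => (hzs n).symm
      rw [this]
      exact tendsto_map.comp (tendsto_add_atTop_nat 1)
    · rw [tendsto_map'_iff, ← tendsto_add_atTop_iff_nat 1]
      refine tendsto_map.congr fun n => ?_
      simp [hzs]
    · intro W' hW' hfreq
      refine mem_map.2 (Eventually.of_forall fun n => ?_)
      obtain ⟨m, hm, hmW⟩ := (frequently_map.1 hfreq).forall_exists_of_atTop n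
      obtain ⟨d, rfl⟩ := Nat.exists_eq_add_of_le hm
      clear hm
      induction d with
      | zero => exact hmW
      | succ d ih => exact ih (hW' (by rw [mem_preimage, ← hzs]; exact hmW))
    · intro W' hW' hfreq
      obtain ⟨m, hmW⟩ := (frequently_map.1 hfreq).exists
      refine mem_map.2 ((eventually_ge_atTop m).mono fun n hn => ?_)
      induction n, hn using Nat.le_induction with
      | base => exact hmW
      | succ n hn ih =>
        refine hW' ?_
        rw [hzs]
        simpa using ih
  obtain ⟨x, hx, hxc⟩ : ∃ x ∈ X₀, MapClusterPt x atTop z := by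
    by_contra! hno
    obtain ⟨A, B, hA, hB, hNA, hNB, hAB⟩ := SeparatedNhds.of_isCompact_isCompact
      hN₁.isCompact hN₂.isCompact hd
    have hAo : IsOpen (A ∩ f ⁻¹' A) := hA.inter (hA.preimage f.continuous)
    have hev : ∀ᶠ n in atTop, z n ∈ A ∩ f ⁻¹' A ∪ B := by
      by_contra hfr
      obtain ⟨x, hxK, hx⟩ := (hAo.union
        hB).isClosed_compl.isCompact.exists_mapClusterPt_of_frequently (not_eventually.1 hfr)
      refine hno x (fun h => hxK ?_) hx
      exact h.imp (fun h => ⟨hNA h, hNA (hf₁.symm ▸ h : x ∈ f ⁻¹' N₁)⟩) fun h => hNB h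
    obtain ⟨j, hj⟩ := eventually_atTop.1 hev
    obtain ⟨m, hm, hmA⟩ := (hc₁.frequently (hAo.mem_nhds
      ⟨hNA hx₁, hNA (hf₁.symm ▸ hx₁ : x₁ ∈ f ⁻¹' N₁)⟩)).forall_exists_of_atTop j
    have hall : ∀ n, m ≤ n → z n ∈ A ∩ f ⁻¹' A := by
      intro n hn
      induction n, hn using Nat.le_induction with
      | base => exact hmA
      | succ n hn ih =>
        refine (hj (n + 1) (by omega)).resolve_right fun h => disjoint_left.1 hAB ?_ h
        rw [hzs]
        exact ih.2
    obtain ⟨n, hn, hnB⟩ := (hc₂.frequently (hB.mem_nhds (hNB hx₂))).forall_exists_of_atTop m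
    exact disjoint_left.1 hAB (hall n hn).1 hnB
  obtain ⟨O, hO, hOc, hOX⟩ := locallyConnectedSpace_iff_connected_subsets.1 ‹_› x X₀
    (hX₀o.mem_nhds hx)
  obtain ⟨j, hj⟩ := (hxc.frequently hO).exists
  obtain ⟨j', hjj', hj'⟩ := (hxc.frequently hO).forall_exists_of_atTop (j + 1)
  obtain ⟨l, rfl⟩ := Nat.exists_eq_add_of_le (show j ≤ j' by omega)
  have hper : ∀ n, j ≤ n → z n ∈ W → z (n + l) ∈ W := by
    intro n hn hnW
    obtain ⟨i, rfl⟩ := Nat.exists_eq_add_of_le' hn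
    by_contra hnot
    obtain ⟨-, ⟨y, hy, rfl⟩, hyW⟩ := (hOc.image _ (f ^ i).continuous.continuousOn)
      |>.inter_frontier_nonempty_of_isOpen ⟨z (i + j), hzadd i j ▸ mem_image_of_mem _ hj, hnW⟩
      hW.isOpen
      (fun h => hnot (h ⟨_, hj', by rw [← hzadd, add_assoc]⟩))
    have : (f ^ i) y ∈ frontier W ∩ X₀ :=
      ⟨hyW, ((Homeomorph.pow_preimage_eq h0 i).symm ▸ hOX hy : y ∈ (f ^ i) ⁻¹' X₀)⟩
    rw [hWfr] at this
    exact this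
  have hrun : ∀ᶠ x in 𝓝ˢ N₁ ⊓ map z atTop, ∀ i ∈ Iic l, (f ^ i) x ∈ W :=
    (eventually_all_finite (finite_Iic l)).2 fun i _ => by
      have ht : Tendsto f (𝓝ˢ N₁ ⊓ map z atTop) (𝓝ˢ N₁ ⊓ map z atTop) := by
        refine (f.continuous.tendsto_nhdsSet
          fun x hx => (hf₁.symm ▸ hx : x ∈ f ⁻¹' N₁)).inf ?_
        rw [tendsto_map'_iff]
        have : f ∘ z = z ∘ (· + 1) := funext fun n => (hzs n).symm
        rw [this]
        exact tendsto_map.comp (tendsto_add_atTop_nat 1)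
      exact Homeomorph.tendsto_pow ht i hW.mem
  obtain ⟨m, hm, hmW⟩ :=
    (frequently_map.1 (hrun.frequently.filter_mono inf_le_right)).forall_exists_of_atTop j
  have hall : ∀ n, m ≤ n → z n ∈ W := by
    intro n
    induction n using Nat.strong_induction_on with
    | _ n ih =>
      intro hn
      rcases le_or_gt n (m + l) with h | h
      · obtain ⟨i, rfl⟩ := Nat.exists_eq_add_of_le' hn
        rw [hzadd]
        exact hmW i (mem_Iic.2 (by omega))
      · have := hper (n - l) (by omega) (ih (n - l) (by omega) (by omega))
        rwa [Nat.sub_add_cancel (by omega)] at this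
  have hout : ∀ᶠ x in 𝓝ˢ N₂ ⊓ map z atTop, x ∉ W := hW.compl_mem
  obtain ⟨n, hn, hnW⟩ :=
    (frequently_map.1 (hout.frequently.filter_mono inf_le_right)).forall_exists_of_atTop m
  exact hnW (hall n hn)

theorem Homeomorph.zpow_preimage_eq {X : Type*} [TopologicalSpace X] {g : X ≃ₜ X} {N : Set X}
    (h : g ⁻¹' N = N) (j : ℤ) : (g ^ j) ⁻¹' N = N := by
  cases j with
  | ofNat n => exact Homeomorph.pow_preimage_eq h n
  | negSucc n =>
    rw [zpow_negSucc]
    exact Homeomorph.inv_preimage_eq (Homeomorph.pow_preimage_eq h (n + 1))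

/-- The closure of the full orbit of a point under a homeomorphism. -/
def orbitClosure {X : Type*} [TopologicalSpace X] (f : X ≃ₜ X) (c : X) : Set X :=
  closure (range fun j : ℤ => (f ^ j) c)

theorem isClosed_orbitClosure {X : Type*} [TopologicalSpace X] (f : X ≃ₜ X) (c : X) :
    IsClosed (orbitClosure f c) :=
  isClosed_closure

theorem zpow_apply_mem_orbitClosure {X : Type*} [TopologicalSpace X] (f : X ≃ₜ X) (c : X) (j : ℤ) :
    (f ^ j) c ∈ orbitClosure f c :=
  subset_closure ⟨j, rfl⟩

theorem self_mem_orbitClosure {X : Type*} [TopologicalSpace X] (f : X ≃ₜ X) (c : X) :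
    c ∈ orbitClosure f c :=
  zpow_apply_mem_orbitClosure f c 0

theorem orbitClosure_subset {X : Type*} [TopologicalSpace X] {f : X ≃ₜ X} {c : X} {N : Set X}
    (hN : IsClosed N) (hf : f ⁻¹' N = N) (hc : c ∈ N) : orbitClosure f c ⊆ N :=
  closure_minimal (range_subset_iff.2 fun j =>
    ((Homeomorph.zpow_preimage_eq hf j).symm ▸ hc : c ∈ (f ^ j) ⁻¹' N)) hN

theorem preimage_orbitClosure {X : Type*} [TopologicalSpace X] (f : X ≃ₜ X) (c : X) :
    f ⁻¹' orbitClosure f c = orbitClosure f c := by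
  rw [orbitClosure, f.preimage_closure]
  congr 1
  ext x
  constructor
  · rintro ⟨j, hj⟩
    refine ⟨j - 1, f.injective ?_⟩
    rw [← hj, ← Homeomorph.mul_apply, ← zpow_one_add, add_sub_cancel]
  · rintro ⟨j, rfl⟩
    refine ⟨1 + j, ?_⟩
    change (f ^ (1 + j)) c = _
    rw [zpow_one_add]
    rfl

theorem orbitClosure_zpow_apply {X : Type*} [TopologicalSpace X] (f : X ≃ₜ X) (c : X) (j : ℤ) :
    orbitClosure f ((f ^ j) c) = orbitClosure f c := by
  refine (orbitClosure_subset (isClosed_orbitClosure f c) (preimage_orbitClosure f c)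
    (zpow_apply_mem_orbitClosure f c j)).antisymm
    (orbitClosure_subset (isClosed_orbitClosure f _) (preimage_orbitClosure f _) ?_)
  have := zpow_apply_mem_orbitClosure f ((f ^ j) c) (-j)
  rwa [← Homeomorph.mul_apply, ← zpow_add, neg_add_cancel] at this

theorem IsMinimalSet.orbitClosure_eq {X : Type*} [MetricSpace X] {f : X ≃ₜ X} {K : Set X}
    (hK : IsMinimalSet f K) {v : X} (hv : v ∈ K) : orbitClosure f v = K := by
  obtain ⟨-, hKc, hKf, hKm⟩ := hK
  have hpre : f ⁻¹' K = K := by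
    conv_lhs => rw [← hKf]
    exact f.injective.preimage_image K
  refine hKm _ (orbitClosure_subset hKc hpre hv) ⟨v, self_mem_orbitClosure f v⟩
    (isClosed_orbitClosure f v) ?_
  conv_lhs => rw [← preimage_orbitClosure]
  exact f.surjective.image_preimage _

theorem closure_range_subset_union_mapClusterPt {X : Type*} [TopologicalSpace X] [T1Space X]
    (u : ℕ → X) : closure (range u) ⊆ range u ∪ {x | MapClusterPt x atTop u} := by
  intro x hx
  by_contra! h
  rw [mem_union, not_or] at h
  have h₂ := h.2
  simp only [mem_ofPred_eq, mapClusterPt_iff_frequently, not_forall, not_frequently] at h₂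
  obtain ⟨s, hs, hev⟩ := h₂
  obtain ⟨m, hm⟩ := eventually_atTop.1 hev
  have hfin : (u '' Iio m).Finite := (finite_Iio m).image u
  obtain ⟨-, ⟨hys, hym⟩, i, rfl⟩ := mem_closure_iff_nhds.1 hx (s ∩ (u '' Iio m)ᶜ)
    (inter_mem hs (hfin.isClosed.isOpen_compl.mem_nhds
      fun ⟨i, _, hi⟩ => h.1 ⟨i, hi⟩))
  exact hm i (not_lt.1 fun hi => hym ⟨i, hi, rfl⟩) hys

theorem orbitClosure_subset_union {X : Type*} [TopologicalSpace X] [T1Space X] (f : X ≃ₜ X)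
    (c : X) : orbitClosure f c ⊆ range (fun j : ℤ => (f ^ j) c) ∪
      ({x | MapClusterPt x atTop fun n : ℕ => (f ^ n) c} ∪
        {x | MapClusterPt x atTop fun n : ℕ => ((f⁻¹ : X ≃ₜ X) ^ n) c}) := by
  have hsub : range (fun j : ℤ => (f ^ j) c) ⊆
      range (fun n : ℕ => (f ^ n) c) ∪ range fun n : ℕ => ((f⁻¹ : X ≃ₜ X) ^ n) c := by
    rintro - ⟨j, rfl⟩
    cases j with
    | ofNat n => exact Or.inl ⟨n, rfl⟩
    | negSucc n => exact Or.inr ⟨n + 1, by simp only [zpow_negSucc, inv_pow]⟩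
  intro x hx
  have hx' := closure_mono hsub hx
  rw [closure_union] at hx'
  rcases hx' with h | h
  · rcases closure_range_subset_union_mapClusterPt _ h with ⟨n, hn⟩ | h
    · exact Or.inl ⟨n, by rw [← hn]; rfl⟩
    · exact Or.inr (Or.inl h)
  · rcases closure_range_subset_union_mapClusterPt _ h with ⟨n, hn⟩ | h
    · exact Or.inl ⟨-n, by rw [← hn]; simp only [zpow_neg, zpow_natCast, inv_pow]⟩
    · exact Or.inr (Or.inr h)

/-- The orbit closure of a point shadowing a point of a minimal set `K` avoids every invariant set
far from some point near `K`. -/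
theorem IsMinimalSet.disjoint_orbitClosure {X : Type*} [MetricSpace X] [CompactSpace X]
    {f : X ≃ₜ X} {K N : Set X} (hK : IsMinimalSet f K) (hN : f ⁻¹' N = N) {ε : ℝ} {v w x x' : X}
    (hv : v ∈ K) (hvw : ∀ j : ℤ, dist ((f ^ j) w) ((f ^ j) v) ≤ ε) (hx' : x' ∈ K)
    (hxx' : dist x x' < ε) (hxN : ∀ u ∈ N, 3 * ε ≤ dist u x) :
    Disjoint (orbitClosure f w) N := by
  have hKf : f ⁻¹' K = K := by
    rw [← hK.orbitClosure_eq hv, preimage_orbitClosure]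
  set P : Set (X × X) := {p | p.2 ∈ K ∧ ∀ j : ℤ, dist ((f ^ j) p.1) ((f ^ j) p.2) ≤ ε}
  have hP : IsClosed P := by
    have hPeq : P = Prod.snd ⁻¹' K ∩
        ⋂ j : ℤ, {p | dist ((f ^ j) p.1) ((f ^ j) p.2) ≤ ε} := by
      ext p
      simp [P]
    rw [hPeq]
    exact (hK.2.1.preimage continuous_snd).inter <| isClosed_iInter fun j => isClosed_le
      (((f ^ j).continuous.comp continuous_fst).dist ((f ^ j).continuous.comp continuous_snd))
      continuous_const
  have hsub : orbitClosure f w ⊆ Prod.fst '' P := by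
    refine closure_minimal (range_subset_iff.2 fun j => ⟨((f ^ j) w, (f ^ j) v),
      ⟨((Homeomorph.zpow_preimage_eq hKf j).symm ▸ hv : v ∈ (f ^ j) ⁻¹' K), fun i => ?_⟩, rfl⟩)
      (hP.isCompact.image continuous_fst).isClosed
    have := hvw (i + j)
    rwa [zpow_add] at this
  rw [disjoint_left]
  intro u hu huN
  obtain ⟨⟨u, v'⟩, ⟨hv', hj⟩, rfl⟩ := hsub hu
  have hε : 0 < ε := dist_nonneg.trans_lt hxx'
  rw [← hK.orbitClosure_eq hv'] at hx'
  obtain ⟨-, ⟨j, rfl⟩, hjx⟩ := Metric.mem_closure_iff.1 hx' ε hε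
  have h₁ := hxN _ ((Homeomorph.zpow_preimage_eq hN j).symm ▸ huN : u ∈ (f ^ j) ⁻¹' N)
  have h₂ := dist_triangle4 ((f ^ j) u) ((f ^ j) v') x' x
  have h₃ := hj j
  rw [dist_comm x' x, dist_comm ((f ^ j) v') x'] at h₂
  dsimp only at h₁ h₂ h₃ hjx
  linarith

theorem frontier_connectedComponentIn_compl_subset {X : Type*} [TopologicalSpace X]
    [LocallyConnectedSpace X] {Φ : Set X} (hΦ : IsClosed Φ) (x : X) :
    frontier (connectedComponentIn Φᶜ x) ⊆ Φ := by
  intro w hw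
  rw [hΦ.isOpen_compl.connectedComponentIn.frontier_eq] at hw
  by_contra hwΦ
  by_cases hx : x ∈ Φᶜ
  · refine hw.2 ((isPreconnected_connectedComponentIn.subset_closure (subset_insert w _)
      (insert_subset hw.1 subset_closure)).subset_connectedComponentIn
      (mem_insert_of_mem _ (mem_connectedComponentIn hx))
      (insert_subset hwΦ (connectedComponentIn_subset _ _)) (mem_insert _ _))
  · rw [connectedComponentIn_eq_empty hx, closure_empty] at hw
    exact hw.1

theorem eventually_forall_exists_dist_lt_of_tendsto_hausdorffDist {X : Type*} [MetricSpace X]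
    [CompactSpace X] {K : ℕ → Set X} {M : Set X} (hK : ∀ n, (K n).Nonempty) (hM : M.Nonempty)
    (h : Tendsto (fun n => hausdorffDist (K n) M) atTop (𝓝 0)) {ε : ℝ} (hε : 0 < ε) :
    ∀ᶠ n in atTop, (∀ x ∈ M, ∃ y ∈ K n, dist x y < ε) ∧ ∀ y ∈ K n, ∃ x ∈ M, dist y x < ε := by
  filter_upwards [h.eventually_lt_const hε] with n hn
  have hfin : hausdorffEDist (K n) M ≠ ⊤ := hausdorffEDist_ne_top_of_nonempty_of_bounded (hK n) hM
    (isBounded_of_compactSpace) (isBounded_of_compactSpace)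
  refine ⟨fun x hx => ?_, fun y hy => exists_dist_lt_of_hausdorffDist_lt hy hn hfin⟩
  obtain ⟨y, hy, hxy⟩ := exists_dist_lt_of_hausdorffDist_lt' hx hn hfin
  exact ⟨y, hy, by rwa [dist_comm]⟩

theorem mapsTo_of_tendsto_hausdorffDist {X : Type*} [MetricSpace X] [CompactSpace X]
    {K : ℕ → Set X} {M : Set X} (hK : ∀ n, (K n).Nonempty) (hM : M.Nonempty) (hMc : IsClosed M)
    (h : Tendsto (fun n => hausdorffDist (K n) M) atTop (𝓝 0)) {g : X → X} (hg : Continuous g)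
    (hgK : ∀ n, MapsTo g (K n) (K n)) : MapsTo g M M := by
  intro x hx
  rw [← hMc.closure_eq, Metric.mem_closure_iff]
  intro ε hε
  obtain ⟨δ, hδ, hgδ⟩ := Metric.continuous_iff.1 hg x (ε / 2) (half_pos hε)
  obtain ⟨n, ⟨hn, -⟩, -, hn'⟩ :=
    ((eventually_forall_exists_dist_lt_of_tendsto_hausdorffDist hK hM h hδ).and
      (eventually_forall_exists_dist_lt_of_tendsto_hausdorffDist hK hM h (half_pos hε))).exists
  obtain ⟨y, hy, hxy⟩ := hn x hx
  obtain ⟨z, hz, hyz⟩ := hn' _ (hgK n hy)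
  refine ⟨z, hz, ?_⟩
  have h₁ := hgδ y (by rwa [dist_comm])
  rw [dist_comm] at h₁
  linarith [dist_triangle (g x) (g y) z]

theorem exists_mem_disjoint_orbitClosure {X : Type*} [MetricSpace X] [CompactSpace X]
    [LocallyConnectedSpace X] {f : X ≃ₜ X} {K : ℕ → Set X} {M N Φ F : Set X}
    (hK : ∀ n, IsMinimalSet f (K n)) (hM : M.Nonempty)
    (hconv : Tendsto (fun n => hausdorffDist (K n) M) atTop (𝓝 0)) (hN : f ⁻¹' N = N) {ε : ℝ}
    (hε : 0 < ε) {x y : X} (hx : x ∈ M) (hxN : ∀ u ∈ N, 3 * ε ≤ dist u x) (hyM : y ∈ M)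
    (hyN : y ∈ N)
    (hF : ∀ C, IsPreconnected C → Disjoint C F → ∀ a ∈ C, ∀ b ∈ C, dist a b ≤ ε)
    (hFΦ : F ⊆ Φ) (hΦ : IsClosed Φ) (hfΦ : f ⁻¹' Φ = Φ) {O : Set X} (hO : O ∈ 𝓝 y) :
    ∃ w ∈ O ∩ Φ, Disjoint (orbitClosure f w) N := by
  obtain ⟨L, hL, hLc, hLO⟩ := locallyConnectedSpace_iff_connected_subsets.1 ‹_› y O hO
  obtain ⟨δ, hδ, hδL⟩ := Metric.mem_nhds_iff.1 hL
  obtain ⟨n, ⟨hn, -⟩, hn', -⟩ :=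
    ((eventually_forall_exists_dist_lt_of_tendsto_hausdorffDist (fun n => (hK n).1) hM hconv
      hδ).and (eventually_forall_exists_dist_lt_of_tendsto_hausdorffDist (fun n => (hK n).1) hM
      hconv hε)).exists
  obtain ⟨v, hv, hyv⟩ := hn y hyM
  obtain ⟨x', hx', hxx'⟩ := hn' x hx
  have hvL : v ∈ L := hδL (by rwa [mem_ball, dist_comm])
  by_cases hvΦ : v ∈ Φ
  · exact ⟨v, ⟨hLO hvL, hvΦ⟩, (hK n).disjoint_orbitClosure hN hv
      (fun j => by rw [dist_self]; exact hε.le) hx' hxx' hxN⟩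
  set S := connectedComponentIn Φᶜ v with hS
  have hvS : v ∈ S := mem_connectedComponentIn hvΦ
  have hclosure : ∀ a ∈ closure S, Disjoint (orbitClosure f a) N := by
    intro a ha
    refine (hK n).disjoint_orbitClosure hN hv (fun j => ?_) hx' hxx' hxN
    refine closure_minimal (t := {a | dist ((f ^ j) a) ((f ^ j) v) ≤ ε}) (fun a haS => ?_)
      (isClosed_le ((f ^ j).continuous.dist continuous_const) continuous_const) ha
    refine hF ((f ^ j) '' S) (isPreconnected_connectedComponentIn.image _
      (f ^ j).continuous.continuousOn) ?_ _ (mem_image_of_mem _ haS) _ (mem_image_of_mem _ hvS)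
    rw [disjoint_left]
    rintro - ⟨b, hb, rfl⟩ hbF
    exact connectedComponentIn_subset _ _ hb
      ((Homeomorph.zpow_preimage_eq hfΦ j) ▸ (hFΦ hbF : b ∈ (f ^ j) ⁻¹' Φ))
  have hyS : y ∉ S := fun h =>
    disjoint_left.1 (hclosure y (subset_closure h)) (self_mem_orbitClosure f y) hyN
  obtain ⟨w, hwL, hw⟩ := hLc.inter_frontier_nonempty_of_isOpen ⟨v, hvL, hvS⟩
    hΦ.isOpen_compl.connectedComponentIn (fun h => hyS (h (mem_of_mem_nhds hL)))
  exact ⟨w, ⟨hLO hwL, frontier_connectedComponentIn_compl_subset hΦ v hw⟩,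
    hclosure w (frontier_subset_closure hw)⟩

/-- A Hausdorff-metric limit of minimal sets of a homeomorphism of a regular curve
is a minimal set. -/
theorem hausdorffLimit_isMinimalSet {X : Type*} [MetricSpace X] [Nonempty X]
    [CompactSpace X] [ConnectedSpace X] (hreg : regularCurveAx X) (f : X ≃ₜ X)
    (Mseq : ℕ → Set X) (hMn : ∀ n, IsMinimalSet (⇑f) (Mseq n))
    (M : Set X) (hMne : M.Nonempty) (hMcl : IsClosed M)
    (hconv : Tendsto (fun n => hausdorffDist (Mseq n) M) atTop (𝓝 0)) :
    IsMinimalSet (⇑f) M := by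
  have := hreg.locallyConnectedSpace
  have hne : ∀ n, (Mseq n).Nonempty := fun n => (hMn n).1
  have hfM : MapsTo f M M := mapsTo_of_tendsto_hausdorffDist hne hMne hMcl hconv f.continuous
    fun n x hx => (hMn n).2.2.1 ▸ mem_image_of_mem f hx
  have hfM' : MapsTo f.symm M M := by
    refine mapsTo_of_tendsto_hausdorffDist hne hMne hMcl hconv f.symm.continuous fun n x hx => ?_
    rw [← (hMn n).2.2.1] at hx
    obtain ⟨y, hy, rfl⟩ := hx
    rwa [f.symm_apply_apply]
  refine ⟨hMne, hMcl, hfM.image_subset.antisymm fun x hx => ⟨_, hfM' hx, f.apply_symm_apply x⟩, ?_⟩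
  intro N hNM hNne hNcl hfN
  have hfN' : f ⁻¹' N = N := by
    conv_lhs => rw [← hfN]
    exact f.injective.preimage_image N
  by_contra hNe
  obtain ⟨x, hx, hxN⟩ := exists_of_ssubset (hNM.ssubset_of_ne hNe)
  obtain ⟨r, hr, hrN⟩ := Metric.isOpen_iff.1 hNcl.isOpen_compl x hxN
  obtain ⟨y, hy⟩ := hNne
  have hr3 : 0 < r / 3 := by positivity
  obtain ⟨F, hFf, hF⟩ := hreg.exists_finite_net hr3
  have hcl : y ∈ closure (⋃ c ∈ F, orbitClosure f c ∩ {w | Disjoint (orbitClosure f w) N}) := by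
    rw [mem_closure_iff_nhds]
    intro O hO
    obtain ⟨w, ⟨hwO, hwΦ⟩, hw⟩ := exists_mem_disjoint_orbitClosure
      (Φ := ⋃ c ∈ F, orbitClosure f c) hMn hMne hconv hfN' hr3 hx
      (fun u hu => by
        by_contra! h
        exact hrN (mem_ball.2 (by linarith)) hu)
      (hNM hy) hy hF (fun c hc => mem_biUnion hc (self_mem_orbitClosure f c))
      (hFf.isClosed_biUnion fun c _ => isClosed_orbitClosure f c)
      (by simp only [preimage_iUnion, preimage_orbitClosure]) hO
    obtain ⟨c, hc, hwc⟩ := mem_iUnion₂.1 hwΦ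
    exact ⟨w, hwO, mem_biUnion hc ⟨hwc, hw⟩⟩
  rw [hFf.closure_biUnion] at hcl
  obtain ⟨c, -, hyc⟩ := mem_iUnion₂.1 hcl
  have hyc' : y ∈ orbitClosure f c :=
    closure_minimal inter_subset_left (isClosed_orbitClosure f c) hyc
  have hsub : orbitClosure f c ∩ {w | Disjoint (orbitClosure f w) N} ⊆
      ({x | MapClusterPt x atTop fun n : ℕ => (f ^ n) c} ∩
        {w | Disjoint (orbitClosure f w) N}) ∪
      ({x | MapClusterPt x atTop fun n : ℕ => ((f⁻¹ : X ≃ₜ X) ^ n) c} ∩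
        {w | Disjoint (orbitClosure f w) N}) := by
    rintro w ⟨hw, hwN⟩
    rcases orbitClosure_subset_union f c hw with ⟨j, rfl⟩ | h
    · rw [mem_ofPred_eq, orbitClosure_zpow_apply] at hwN
      exact absurd hy (disjoint_left.1 hwN hyc')
    · exact h.imp (fun h => ⟨h, hwN⟩) fun h => ⟨h, hwN⟩
  have hcontra : ∀ g : X ≃ₜ X, (∀ K : Set X, f ⁻¹' K = K → g ⁻¹' K = K) →
      y ∉ closure ({x | MapClusterPt x atTop fun n : ℕ => (g ^ n) c} ∩
        {w | Disjoint (orbitClosure f w) N}) := by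
    intro g hg hyg
    have hyω : MapClusterPt y atTop fun n : ℕ => (g ^ n) c :=
      closure_minimal inter_subset_left isClosed_setOfPred_clusterPt hyg
    obtain ⟨w, hwω, hwN⟩ := closure_nonempty_iff.1 ⟨y, hyg⟩
    exact hreg.not_mapClusterPt_of_disjoint g hNcl (isClosed_orbitClosure f w) hwN.symm
      (hg _ hfN') (hg _ (preimage_orbitClosure f w)) hy (self_mem_orbitClosure f w) hyω hwω
  have hyu := closure_mono hsub hyc
  rw [closure_union] at hyu
  exact hyu.elim (hcontra f fun K hK => hK) (hcontra f⁻¹ fun K hK => Homeomorph.inv_preimage_eq hK)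
end

section
/- Let X be a regular curve, f : X → X a homeomorphism, and (M_n) a sequence of minimal sets of f converging in the Hausdorff metric to a nonempty closed set M. If every point of M is a periodic point of f, then M is a single periodic orbit of f. -/
open Set Filter Metric Topology

/-- Points of a connected compact space whose neighborhoods can be taken with finite boundary
have small connected neighborhoods. -/
lemma exists_isPreconnected_mem_nhds_subset {X : Type*} [MetricSpace X] [CompactSpace X]
    [ConnectedSpace X] (hreg : regularCurveAx X) {x : X} {V : Set X} (hV : V ∈ 𝓝 x) :
    ∃ C ∈ 𝓝 x, C ⊆ V ∧ IsPreconnected C := by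
  obtain ⟨K, hK, hKcl, hKV⟩ := exists_mem_nhds_isClosed_subset hV
  obtain ⟨U, hUo, hxU, hUK, hfin⟩ :=
    hreg x (interior K) isOpen_interior (mem_interior_iff_mem_nhds.2 hK)
  have hUV : closure U ⊆ V := (closure_minimal (hUK.trans interior_subset) hKcl).trans hKV
  let Y := closure U
  have : CompactSpace Y := isCompact_iff_compactSpace.1 isClosed_closure.isCompact
  let y : Y := ⟨x, subset_closure hxU⟩
  have hcomp := connectedComponent_eq_iInter_isClopen y
  have hsep : ∀ z : Y, z ∉ connectedComponent y → ∃ Q : Set Y, IsClopen Q ∧ y ∈ Q ∧ z ∉ Q := by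
    intro z hz
    rw [hcomp] at hz
    simp only [mem_iInter, Subtype.forall, not_forall] at hz
    obtain ⟨Q, ⟨h1, h2⟩, h3⟩ := hz
    exact ⟨Q, h1, h2, h3⟩
  choose! Q hQ using hsep
  let E : Set Y := {z | (z : X) ∈ frontier U ∧ z ∉ connectedComponent y}
  have hE : E.Finite :=
    (hfin.preimage Subtype.val_injective.injOn).subset fun z hz => hz.1
  let R : Set Y := ⋂ e ∈ E, Q e
  have hR : IsClopen R := hE.isClopen_biInter fun e he => (hQ e he.2).1
  have hyR : y ∈ R := mem_iInter₂.2 fun e he => (hQ e he.2).2.1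
  have hRC : R ⊆ connectedComponent y := by
    intro z hzR
    by_contra hz
    obtain ⟨hcl, hyQ, hzQ⟩ := hQ z hz
    have hS : IsClopen (R \ Q z) := hR.diff hcl
    obtain ⟨O, hO, hOS⟩ := isOpen_induced_iff.1 hS.isOpen
    have himg : Subtype.val '' (R \ Q z) = O ∩ U := by
      ext a
      constructor
      · rintro ⟨b, hb, rfl⟩
        have hbO : b ∈ Subtype.val ⁻¹' O := hOS ▸ hb
        refine ⟨hbO, ?_⟩
        by_contra hbU
        have hbf : (b : X) ∈ frontier U := by
          rw [hUo.frontier_eq]; exact ⟨b.2, hbU⟩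
        by_cases hbC : b ∈ connectedComponent y
        · exact hb.2 (hcl.connectedComponent_subset hyQ hbC)
        · exact (hQ b hbC).2.2 (mem_iInter₂.1 hb.1 b ⟨hbf, hbC⟩)
      · rintro ⟨haO, haU⟩
        refine ⟨⟨a, subset_closure haU⟩, ?_, rfl⟩
        rw [← hOS]; exact haO
    have hclopen : IsClopen (Subtype.val '' (R \ Q z)) :=
      ⟨isClosed_closure.isClosedEmbedding_subtypeVal.isClosedMap _ hS.isClosed,
        himg ▸ hO.inter hUo⟩
    have huniv := hclopen.eq_univ ⟨z, z, ⟨hzR, hzQ⟩, rfl⟩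
    obtain ⟨b, hb, hbx⟩ := huniv.symm ▸ mem_univ x
    have : b = y := Subtype.ext hbx
    exact hb.2 (this ▸ hyQ)
  refine ⟨Subtype.val '' connectedComponent y, ?_, ?_,
    isPreconnected_connectedComponent.image _ continuous_subtype_val.continuousOn⟩
  · obtain ⟨O, hO, hOR⟩ := isOpen_induced_iff.1 hR.isOpen
    have hyO : y ∈ Subtype.val ⁻¹' O := hOR ▸ hyR
    filter_upwards [(hO.inter hUo).mem_nhds ⟨hyO, hxU⟩] with a ha
    refine ⟨⟨a, subset_closure ha.2⟩, hRC ?_, rfl⟩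
    rw [← hOR]; exact ha.1
  · rintro _ ⟨b, -, rfl⟩
    exact hUV b.2

lemma IsPreconnected.inter_frontier_nonempty_of_isOpen_s3 {X : Type*} [TopologicalSpace X]
    {C G : Set X} (hC : IsPreconnected C) (hG : IsOpen G) {a b : X} (ha : a ∈ C) (haG : a ∈ G)
    (hb : b ∈ C) (hbG : b ∉ G) : (C ∩ frontier G).Nonempty := by
  by_contra h
  have hsub : C ⊆ G ∪ (closure G)ᶜ := by
    intro c hc
    by_cases hcG : c ∈ G
    · exact Or.inl hcG
    · refine Or.inr fun hcc => h ⟨c, hc, ?_⟩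
      rw [hG.frontier_eq]; exact ⟨hcc, hcG⟩
  obtain ⟨c, -, hc1, hc2⟩ := hC G (closure G)ᶜ hG isClosed_closure.isOpen_compl hsub
    ⟨a, ha, haG⟩ ⟨b, hb, (hsub hb).resolve_left hbG⟩
  exact hc2 (subset_closure hc1)

lemma Homeomorph.coe_npow {X : Type*} [TopologicalSpace X] (f : X ≃ₜ X) (n : ℕ) :
    ⇑(f ^ n) = (⇑f)^[n] := by
  induction n with
  | zero => rfl
  | succ n ih => rw [pow_succ, Function.iterate_succ, ← ih]; rfl

lemma Homeomorph.zpow_apply_eq_self {X : Type*} [TopologicalSpace X] {g : X ≃ₜ X} {x : X}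
    (h : g x = x) (i : ℤ) : (g ^ i) x = x := by
  have hn : ∀ n : ℕ, (g ^ n) x = x := fun n => by
    rw [Homeomorph.coe_npow]; exact Function.iterate_fixed h n
  obtain ⟨n, rfl | rfl⟩ := i.eq_nat_or_neg
  · rw [zpow_natCast, hn]
  · rw [zpow_neg, zpow_natCast, Homeomorph.inv_apply, Homeomorph.symm_apply_eq, hn]

/-- The full orbit of a point of a minimal set meets every open set the minimal set meets. -/
lemma IsMinimalSet.exists_zpow_mem {X : Type*} [MetricSpace X] {f : X ≃ₜ X} {N : Set X}
    (hN : IsMinimalSet f N) {z : X} (hz : z ∈ N) {O : Set X} (hO : IsOpen O)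
    (hON : (O ∩ N).Nonempty) : ∃ t : ℤ, (f ^ t) z ∈ O := by
  obtain ⟨-, hcl, hinv, hmin⟩ := hN
  have hfwd : ∀ x ∈ N, f x ∈ N := fun x hx => hinv ▸ mem_image_of_mem f hx
  have hbwd : ∀ x ∈ N, f.symm x ∈ N := by
    intro x hx
    rw [← hinv] at hx
    obtain ⟨y, hy, rfl⟩ := hx
    simpa using hy
  have horb : ∀ t : ℤ, (f ^ t) z ∈ N := by
    intro t
    induction t using Int.induction_on with
    | zero => simpa using hz
    | succ n ih => rw [add_comm, zpow_one_add]; exact hfwd _ ih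
    | pred n ih => rw [sub_eq_add_neg, add_comm, zpow_add, zpow_neg_one]; exact hbwd _ ih
  have himg : f '' range (fun t : ℤ => (f ^ t) z) = range (fun t : ℤ => (f ^ t) z) := by
    ext a
    constructor
    · rintro ⟨_, ⟨t, rfl⟩, rfl⟩
      exact ⟨1 + t, by simp only [zpow_one_add]; rfl⟩
    · rintro ⟨t, rfl⟩
      refine ⟨_, ⟨-1 + t, rfl⟩, ?_⟩
      simp only [zpow_add, zpow_neg_one, Homeomorph.mul_apply, Homeomorph.inv_apply,
        Homeomorph.apply_symm_apply]
  have heq := hmin (closure (range fun t : ℤ => (f ^ t) z))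
    (closure_minimal (range_subset_iff.2 horb) hcl) (range_nonempty _).closure isClosed_closure
    (by rw [f.image_closure, himg])
  obtain ⟨a, haO, haN⟩ := hON
  rw [← heq] at haN
  obtain ⟨_, hb, ⟨t, rfl⟩⟩ := mem_closure_iff.1 haN O hO haO
  exact ⟨t, hb⟩

/-- Near an accumulation point `w` of fixed points of `f ^ k`, the approximating minimal sets
spend at least three quarters of each time window of a suitable phase. -/
lemma eventually_exists_sojourn {X : Type*} [MetricSpace X] [CompactSpace X]
    [ConnectedSpace X] (hreg : regularCurveAx X) (f : X ≃ₜ X) (k : ℕ) (Mseq : ℕ → Set X)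
    (hMn : ∀ n, IsMinimalSet (⇑f) (Mseq n)) (M : Set X)
    (hlow : ∀ O, IsOpen O → (O ∩ M).Nonempty → ∀ᶠ n in atTop, (O ∩ Mseq n).Nonempty)
    (w : X) (hw : ∀ G, IsOpen G → w ∈ G → (G ∩ {x ∈ M | (f ^ k) x = x}).Infinite)
    (B : Set X) (hB : IsOpen B) (hwB : w ∈ B) :
    ∀ᶠ n in atTop, ∀ z ∈ Mseq n, ∃ T : Finset ℤ, ∀ L : ℕ, 0 < L → ∃ t ∈ T,
      4 * (Ico (0 : ℤ) L ∩ {i | (f ^ (k * i + t)) z ∉ B}).ncard ≤ L := by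
  classical
  obtain ⟨G, hGo, hwG, hGB, hfin⟩ := hreg w B hB hwB
  let E := hfin.toFinset
  obtain ⟨S, hSsub, hScard⟩ := (hw G hGo hwG).exists_subset_card_eq (4 * E.card + 1)
  obtain ⟨U, hU, hdisj⟩ := S.finite_toSet.t2_separation
  choose C hCn hCU hCp using fun x =>
    exists_isPreconnected_mem_nhds_subset hreg ((hU x).2.mem_nhds (hU x).1)
  have hev : ∀ᶠ n in atTop, ∀ x ∈ S, (interior (C x) ∩ Mseq n).Nonempty := by
    rw [eventually_all_finset]
    intro x hx
    exact hlow _ isOpen_interior ⟨x, mem_interior_iff_mem_nhds.2 (hCn x), (hSsub hx).2.1⟩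
  filter_upwards [hev] with n hn z hz
  have ht : ∀ x, ∃ t : ℤ, x ∈ S → (f ^ t) z ∈ C x := by
    intro x
    by_cases hx : x ∈ S
    · obtain ⟨t, ht⟩ := (hMn n).exists_zpow_mem hz isOpen_interior (hn x hx)
      exact ⟨t, fun _ => interior_subset ht⟩
    · exact ⟨0, fun h => absurd h hx⟩
  choose t ht using ht
  refine ⟨S.image t, fun L hL => ?_⟩
  by_contra! hbad
  let P : Finset (ℤ × X) := Finset.Ico (0 : ℤ) L ×ˢ E
  let A : X → Finset (ℤ × X) := fun x => P.filter fun p => (f ^ (-(k * p.1))) p.2 ∈ C x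
  have hle : ∀ x ∈ S, L + 1 ≤ 4 * (A x).card := by
    intro x hx
    refine (hbad (t x) (Finset.mem_image_of_mem t hx)).trans_le ?_
    refine Nat.mul_le_mul_left 4 ?_
    rw [← Set.ncard_coe_finset (A x)]
    refine le_trans (Set.ncard_le_ncard ?_ (((A x).finite_toSet).image Prod.fst))
      (Set.ncard_image_le (A x).finite_toSet)
    rintro i ⟨hi, hiB⟩
    have hpre : IsPreconnected ((f ^ (k * i)) '' C x) :=
      (hCp x).image _ (f ^ (k * i)).continuous.continuousOn
    have hfix : (f ^ (k * i)) x = x := by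
      rw [zpow_mul, zpow_natCast]
      exact Homeomorph.zpow_apply_eq_self (hSsub hx).2.2 i
    obtain ⟨e, ⟨c, hc, hce⟩, heE⟩ := hpre.inter_frontier_nonempty_of_isOpen_s3 hGo
      (a := x) (b := (f ^ (k * i + t x)) z) ⟨x, mem_of_mem_nhds (hCn x), hfix⟩ (hSsub hx).1
      ⟨_, ht x hx, by rw [zpow_add]; rfl⟩ (fun h => hiB (hGB h))
    refine ⟨(i, e), ?_, rfl⟩
    simp only [A, P, E, Finset.coe_filter, Finset.mem_product, Finset.mem_Ico, mem_ofPred_eq,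
      Set.Finite.mem_toFinset]
    refine ⟨⟨hi, heE⟩, ?_⟩
    rw [← hce, zpow_neg, Homeomorph.inv_apply, Homeomorph.symm_apply_apply]
    exact hc
  have hAd : (S : Set X).PairwiseDisjoint A := by
    intro x hx y hy hxy
    rw [Function.onFun, Finset.disjoint_left]
    intro p hp hp'
    exact (Set.disjoint_left.1 (hdisj hx hy hxy)) (hCU x (Finset.mem_filter.1 hp).2)
      (hCU y (Finset.mem_filter.1 hp').2)
  have hsum : ∑ x ∈ S, (A x).card ≤ L * E.card := by
    rw [← Finset.card_biUnion fun x hx y hy hxy => hAd hx hy hxy]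
    refine (Finset.card_le_card (Finset.biUnion_subset.2 fun x _ =>
      Finset.filter_subset _ P)).trans ?_
    simp [P]
  have h1 : S.card * (L + 1) ≤ 4 * ∑ x ∈ S, (A x).card := by
    rw [Finset.mul_sum, ← smul_eq_mul]
    exact Finset.card_nsmul_le_sum _ _ _ hle
  rw [hScard] at h1
  nlinarith

lemma finite_range_iterate {X : Type*} {f : X → X} {x : X} {n : ℕ} (hn : 1 ≤ n)
    (hx : f^[n] x = x) : (range fun i : ℕ => f^[i] x).Finite := by
  refine ((finite_Iio n).image fun i : ℕ => f^[i] x).subset ?_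
  rintro _ ⟨i, rfl⟩
  exact ⟨i % n, Nat.mod_lt _ hn, Function.IsPeriodicPt.iterate_mod_apply hx i⟩

lemma eventually_inter_nonempty_of_hausdorffDist {X : Type*} [MetricSpace X]
    {Mseq : ℕ → Set X} {M : Set X} (hfin : ∀ n, hausdorffEDist (Mseq n) M ≠ ⊤)
    (hconv : Tendsto (fun n => hausdorffDist (Mseq n) M) atTop (𝓝 0)) {O : Set X}
    (hO : IsOpen O) (hOM : (O ∩ M).Nonempty) : ∀ᶠ n in atTop, (O ∩ Mseq n).Nonempty := by
  obtain ⟨x, hxO, hxM⟩ := hOM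
  obtain ⟨ε, hε, hball⟩ := Metric.isOpen_iff.1 hO x hxO
  filter_upwards [hconv.eventually (gt_mem_nhds hε)] with n hn
  obtain ⟨y, hy, hxy⟩ := exists_dist_lt_of_hausdorffDist_lt' hxM hn (hfin n)
  exact ⟨y, hball hxy, hy⟩

lemma eventually_subset_of_hausdorffDist {X : Type*} [MetricSpace X]
    {Mseq : ℕ → Set X} {M : Set X} (hM : IsCompact M)
    (hfin : ∀ n, hausdorffEDist (Mseq n) M ≠ ⊤)
    (hconv : Tendsto (fun n => hausdorffDist (Mseq n) M) atTop (𝓝 0)) {O : Set X}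
    (hO : IsOpen O) (hMO : M ⊆ O) : ∀ᶠ n in atTop, Mseq n ⊆ O := by
  obtain ⟨ε, hε, hthick⟩ := hM.exists_thickening_subset_open hO hMO
  filter_upwards [hconv.eventually (gt_mem_nhds hε)] with n hn x hx
  obtain ⟨y, hy, hxy⟩ := exists_dist_lt_of_hausdorffDist_lt hx hn (hfin n)
  exact hthick (mem_thickening_iff.2 ⟨y, hy, hxy⟩)

/-- A limit of minimal sets is not the union of two disjoint nonempty closed forward
invariant sets. -/
lemma eq_of_isClosed_of_isClosed_diff {X : Type*} [MetricSpace X] {f : X ≃ₜ X}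
    {Mseq : ℕ → Set X} (hMn : ∀ n, IsMinimalSet (⇑f) (Mseq n)) {M : Set X}
    (hlow : ∀ O, IsOpen O → (O ∩ M).Nonempty → ∀ᶠ n in atTop, (O ∩ Mseq n).Nonempty)
    (hup : ∀ O, IsOpen O → M ⊆ O → ∀ᶠ n in atTop, Mseq n ⊆ O)
    {A : Set X} (hAM : A ⊆ M) (hA : IsClosed A) (hA' : IsClosed (M \ A)) (hne : A.Nonempty)
    (hfA : MapsTo f A A) (hfA' : MapsTo f (M \ A) (M \ A)) : A = M := by
  by_contra hneq
  have hne' : (M \ A).Nonempty := sdiff_nonempty.2 fun h => hneq (hAM.antisymm h)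
  obtain ⟨U, V, hU, hV, hAU, hAV, hUV⟩ :=
    normal_separation hA hA' disjoint_sdiff_right
  have hcover : M ⊆ (U ∩ f ⁻¹' U) ∪ (V ∩ f ⁻¹' V) := by
    intro x hx
    by_cases hxA : x ∈ A
    · exact Or.inl ⟨hAU hxA, hAU (hfA hxA)⟩
    · exact Or.inr ⟨hAV ⟨hx, hxA⟩, hAV (hfA' ⟨hx, hxA⟩)⟩
  obtain ⟨n, hn1, hn2, hn3⟩ := ((hup _ ((hU.inter (hU.preimage f.continuous)).union
    (hV.inter (hV.preimage f.continuous))) hcover).and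
    ((hlow U hU (hne.mono fun x hx => ⟨hAU hx, hAM hx⟩)).and
    (hlow V hV (hne'.mono fun x hx => ⟨hAV hx, hx.1⟩)))).exists
  obtain ⟨-, hcl, hinv, hmin⟩ := hMn n
  have hdisj : ∀ x, x ∈ U → x ∉ V := fun _ hx => Set.disjoint_left.1 hUV hx
  have hstep : ∀ x ∈ Mseq n, (x ∈ U ↔ f x ∈ U) := by
    intro x hx
    rcases hn1 hx with h | h
    · exact iff_of_true h.1 h.2
    · exact iff_of_false (fun h' => hdisj _ h' h.1) (fun h' => hdisj _ h' h.2)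
  have heq : U ∩ Mseq n = Mseq n \ V := by
    ext x
    constructor
    · rintro ⟨h1, h2⟩
      exact ⟨h2, hdisj x h1⟩
    · rintro ⟨h1, h2⟩
      rcases hn1 h1 with h | h
      · exact ⟨h.1, h1⟩
      · exact absurd h.1 h2
  have hall := hmin (U ∩ Mseq n) inter_subset_right hn2
    (by rw [heq, Set.sdiff_eq]; exact hcl.inter hV.isClosed_compl) (by
      ext y
      constructor
      · rintro ⟨x, ⟨hxU, hx⟩, rfl⟩
        exact ⟨(hstep x hx).1 hxU, hinv ▸ mem_image_of_mem f hx⟩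
      · rintro ⟨hyU, hy⟩
        rw [← hinv] at hy
        obtain ⟨x, hx, rfl⟩ := hy
        exact ⟨x, ⟨(hstep x hx).2 hyU, hx⟩, rfl⟩)
  obtain ⟨x, hxV, hx⟩ := hn3
  rw [← hall] at hx
  exact hdisj x hx.1 hxV

/-- A limit of minimal sets is forward invariant. -/
lemma mapsTo_of_hausdorffLimit {X : Type*} [MetricSpace X] {f : X ≃ₜ X}
    {Mseq : ℕ → Set X} (hMn : ∀ n, IsMinimalSet (⇑f) (Mseq n)) {M : Set X} (hM : IsClosed M)
    (hlow : ∀ O, IsOpen O → (O ∩ M).Nonempty → ∀ᶠ n in atTop, (O ∩ Mseq n).Nonempty)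
    (hup : ∀ O, IsOpen O → M ⊆ O → ∀ᶠ n in atTop, Mseq n ⊆ O) : MapsTo f M M := by
  intro x hx
  by_contra hfx
  obtain ⟨U, V, hU, hV, hMU, hxV, hUV⟩ := normal_separation hM
    isClosed_singleton (Set.disjoint_singleton_right.2 hfx)
  obtain ⟨n, hn, y, hyV, hy⟩ := ((hup U hU hMU).and
    (hlow (f ⁻¹' V) (hV.preimage f.continuous) ⟨x, hxV rfl, hx⟩)).exists
  exact Set.disjoint_left.1 hUV (hn ((hMn n).2.2.1 ▸ mem_image_of_mem f hy)) hyV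

/-- If all points of a compact set are periodic, some relatively open part of it consists of
fixed points of a single iterate. -/
lemma exists_isOpen_inter_subset_fixed {X : Type*} [MetricSpace X] [CompactSpace X] (f : X ≃ₜ X)
    {M : Set X} (hMne : M.Nonempty) (hMcl : IsClosed M)
    (hper : ∀ x ∈ M, ∃ n : ℕ, 1 ≤ n ∧ (⇑f)^[n] x = x) :
    ∃ k : ℕ, 1 ≤ k ∧ ∃ W, IsOpen W ∧ (W ∩ M).Nonempty ∧ ∀ x ∈ W ∩ M, (f ^ k) x = x := by
  have : CompactSpace M := isCompact_iff_compactSpace.1 hMcl.isCompact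
  have : Nonempty M := hMne.to_subtype
  obtain ⟨k, hk⟩ := nonempty_interior_of_iUnion_of_closed
    (f := fun k : ℕ => {x : M | (f ^ (k + 1)) x = x})
    (fun k => isClosed_eq ((f ^ (k + 1)).continuous.comp continuous_subtype_val)
      continuous_subtype_val)
    (eq_univ_of_forall fun x => by
      obtain ⟨n, hn, hx⟩ := hper x x.2
      refine mem_iUnion.2 ⟨n - 1, ?_⟩
      change (f ^ (n - 1 + 1)) (x : X) = x
      rw [Nat.sub_add_cancel hn, f.coe_npow, hx])
  obtain ⟨W, hW, hWint⟩ := isOpen_induced_iff.1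
    (isOpen_interior (s := {x : M | (f ^ (k + 1)) (x : X) = x}))
  refine ⟨k + 1, by omega, W, hW, ?_, ?_⟩
  · obtain ⟨x, hx⟩ := hk
    rw [← hWint] at hx
    exact ⟨x, hx, x.2⟩
  · rintro x ⟨hxW, hxM⟩
    have : (⟨x, hxM⟩ : M) ∈ Subtype.val ⁻¹' W := hxW
    rw [hWint] at this
    have h := interior_subset this
    exact h

/-- An orbit cannot spend three quarters of arbitrarily long time windows in two sets neither of
which is carried into the other by one of the intermediate iterates. -/
lemma false_of_two_sojourns {X : Type*} [TopologicalSpace X] (f : X ≃ₜ X) {k : ℕ} (hk : 1 ≤ k)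
    {B B' : Set X} (hBB' : ∀ c < k, ∀ a ∈ B, (f ^ c) a ∉ B') (z : X) (T T' : Finset ℤ)
    (hT : ∀ L : ℕ, 0 < L → ∃ t ∈ T,
      4 * (Ico (0 : ℤ) L ∩ {i | (f ^ (k * i + t)) z ∉ B}).ncard ≤ L)
    (hT' : ∀ L : ℕ, 0 < L → ∃ t ∈ T',
      4 * (Ico (0 : ℤ) L ∩ {i | (f ^ (k * i + t)) z ∉ B'}).ncard ≤ L) : False := by
  let D := (T ×ˢ T').sup fun p => (p.2 - p.1).natAbs
  obtain ⟨t, ht, h1⟩ := hT (4 * D + 1) (by omega)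
  obtain ⟨t', ht', h2⟩ := hT' (4 * D + 1) (by omega)
  have hD : (t' - t).natAbs ≤ D :=
    Finset.le_sup (f := fun p : ℤ × ℤ => (p.2 - p.1).natAbs) (Finset.mk_mem_product ht ht')
  set Z := Ico (0 : ℤ) (4 * D + 1 : ℕ) ∩ {i | (f ^ (k * i + t)) z ∉ B} with hZ
  set Z' := Ico (0 : ℤ) (4 * D + 1 : ℕ) ∩ {i | (f ^ (k * i + t')) z ∉ B'} with hZ'
  set b := (t' - t) / (k : ℤ) with hb
  have hbD : b.natAbs ≤ D := (Int.natAbs_ediv_le_natAbs _ _).trans hD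
  have hc0 : 0 ≤ (t' - t) % (k : ℤ) := Int.emod_nonneg _ (by omega)
  have hck : (t' - t) % (k : ℤ) < k := Int.emod_lt_of_pos _ (by omega)
  have hdiv := Int.mul_ediv_add_emod (t' - t) k
  obtain ⟨c, hc⟩ := Int.eq_ofNat_of_zero_le hc0
  have hsub : Ico (D : ℤ) (3 * D + 1) ⊆ Z ∪ (fun i => i + b) '' Z' := by
    rintro i ⟨hi1, hi2⟩
    by_contra hi
    rw [mem_union, not_or] at hi
    have hiB : (f ^ (k * i + t)) z ∈ B := by
      by_contra h
      exact hi.1 ⟨⟨by omega, by push_cast; omega⟩, h⟩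
    have hiB' : (f ^ (k * (i - b) + t')) z ∈ B' := by
      by_contra h
      exact hi.2 ⟨i - b, ⟨⟨by omega, by push_cast; omega⟩, h⟩, by simp⟩
    refine hBB' c (by omega) _ hiB ?_
    have hexp : k * (i - b) + t' = (c : ℤ) + (k * i + t) := by
      rw [← hb, hc] at hdiv
      linarith
    rw [hexp, zpow_add, zpow_natCast] at hiB'
    exact hiB'
  have hZfin : Z.Finite := (finite_Ico _ _).subset inter_subset_left
  have hZfin' : Z'.Finite := (finite_Ico _ _).subset inter_subset_left
  have hcard := (ncard_le_ncard hsub (hZfin.union (hZfin'.image _))).trans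
    ((ncard_union_le _ _).trans (Nat.add_le_add_left (ncard_image_le hZfin') _))
  have hIco : (Ico (D : ℤ) (3 * D + 1)).ncard = 2 * D + 1 := by
    rw [← Finset.coe_Ico, ncard_coe_finset, Int.card_Ico]
    omega
  omega

lemma exists_isOpen_iterate_notMem {X : Type*} [TopologicalSpace X] [T2Space X] (f : X ≃ₜ X)
    (k : ℕ) {w w' : X} (hww' : ∀ c < k, (f ^ c) w ≠ w') :
    ∃ B B', IsOpen B ∧ w ∈ B ∧ IsOpen B' ∧ w' ∈ B' ∧ ∀ c < k, ∀ a ∈ B, (f ^ c) a ∉ B' := by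
  choose! U V hU hV hwU hwV hUV using fun c hc => t2_separation (hww' c hc)
  refine ⟨⋂ c ∈ Iio k, (f ^ c) ⁻¹' U c, ⋂ c ∈ Iio k, V c,
    (finite_Iio k).isOpen_biInter fun c hc => (hU c hc).preimage (f ^ c).continuous,
    mem_iInter₂.2 hwU, (finite_Iio k).isOpen_biInter hV, mem_iInter₂.2 hwV, ?_⟩
  intro c hc a ha ha'
  exact Set.disjoint_left.1 (hUV c hc) (mem_iInter₂.1 ha c hc) (mem_iInter₂.1 ha' c hc)

/-- If a Hausdorff limit of minimal sets consists of periodic points, then it is a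
single periodic orbit. -/
theorem hausdorffLimit_of_periodic_isPeriodicOrbit {X : Type*} [MetricSpace X] [Nonempty X]
    [CompactSpace X] [ConnectedSpace X] (hreg : regularCurveAx X) (f : X ≃ₜ X)
    (Mseq : ℕ → Set X) (hMn : ∀ n, IsMinimalSet (⇑f) (Mseq n))
    (M : Set X) (hMne : M.Nonempty) (hMcl : IsClosed M)
    (hconv : Tendsto (fun n => hausdorffDist (Mseq n) M) atTop (𝓝 0))
    (hper : ∀ x ∈ M, ∃ n : ℕ, 1 ≤ n ∧ (⇑f)^[n] x = x) :
    ∃ x ∈ M, ∃ n : ℕ, 1 ≤ n ∧ (⇑f)^[n] x = x ∧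
      M = Set.range (fun i : ℕ => (⇑f)^[i] x) := by
  have hbdd : ∀ n, hausdorffEDist (Mseq n) M ≠ ⊤ := fun n =>
    hausdorffEDist_ne_top_of_nonempty_of_bounded (hMn n).1 hMne
      (hMn n).2.1.isCompact.isBounded hMcl.isCompact.isBounded
  have hlow : ∀ O, IsOpen O → (O ∩ M).Nonempty → ∀ᶠ n in atTop, (O ∩ Mseq n).Nonempty :=
    fun O hO => eventually_inter_nonempty_of_hausdorffDist hbdd hconv hO
  have hup : ∀ O, IsOpen O → M ⊆ O → ∀ᶠ n in atTop, Mseq n ⊆ O :=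
    fun O hO => eventually_subset_of_hausdorffDist hMcl.isCompact hbdd hconv hO
  have hmaps := mapsTo_of_hausdorffLimit hMn hMcl hlow hup
  have hiter : ∀ (i : ℕ) (x : X), x ∈ M → (⇑f)^[i] x ∈ M := fun i x hx => hmaps.iterate i hx
  have hback : ∀ x, f x ∈ M → x ∈ M ∧ ∃ m, x = (⇑f)^[m] (f x) := by
    intro x hx
    obtain ⟨m, hm, hfx⟩ := hper _ hx
    obtain ⟨m, rfl⟩ := Nat.exists_eq_add_of_le' hm
    rw [Function.iterate_succ_apply'] at hfx
    have hxm := (f.injective hfx).symm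
    exact ⟨hxm ▸ hiter m _ hx, m, hxm⟩
  have hiterback : ∀ (i : ℕ) (x : X), (⇑f)^[i] x ∈ M → x ∈ M := by
    intro i
    induction i with
    | zero => exact fun x hx => hx
    | succ i ih => exact fun x hx => (hback x (ih (f x) hx)).1
  by_contra hcon
  have hperfect : ∀ O, IsOpen O → ∀ a ∈ O ∩ M, (O ∩ M).Infinite := by
    rintro O hO a ⟨haO, haM⟩ hfin
    obtain ⟨n, hn, hna⟩ := hper a haM
    refine hcon ⟨a, haM, n, hn, hna, (eq_of_isClosed_of_isClosed_diff hMn hlow hup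
      (range_subset_iff.2 fun i => hiter i a haM) (finite_range_iterate hn hna).isClosed ?_
      (range_nonempty _) ?_ ?_).symm⟩
    · have hO' : IsOpen (O \ ((O ∩ M) \ {a})) := hO.sdiff hfin.sdiff.isClosed
      have heq : M \ range (fun i : ℕ => (⇑f)^[i] a)
          = M \ ⋃ i : ℕ, (f ^ i) '' (O \ ((O ∩ M) \ {a})) := by
        ext x
        refine and_congr_right fun hx => not_congr ?_
        rw [mem_iUnion, mem_range]
        refine exists_congr fun i => ?_
        rw [f.coe_npow]
        constructor
        · rintro rfl
          exact ⟨a, ⟨haO, fun h => h.2 rfl⟩, rfl⟩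
        · rintro ⟨y, ⟨hyO, hy⟩, rfl⟩
          by_cases hya : y = a
          · rw [hya]
          · exact absurd ⟨⟨hyO, hiterback i y hx⟩, hya⟩ hy
      rw [heq, Set.sdiff_eq]
      exact hMcl.inter (isOpen_iUnion fun i => (f ^ i).isOpenMap _ hO').isClosed_compl
    · rintro _ ⟨i, rfl⟩
      exact ⟨i + 1, Function.iterate_succ_apply' _ _ _⟩
    · rintro x ⟨hx, hxA⟩
      refine ⟨hmaps hx, ?_⟩
      rintro ⟨i, hi⟩
      obtain ⟨-, m, hm⟩ := hback x (hmaps hx)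
      refine hxA ⟨m + i, ?_⟩
      rw [hm, ← hi]
      exact Function.iterate_add_apply _ _ _ _
  obtain ⟨k, hk, W, hW, ⟨w, hw⟩, hWfix⟩ := exists_isOpen_inter_subset_fixed f hMne hMcl hper
  obtain ⟨n₀, hn₀, hwn₀⟩ := hper w hw.2
  obtain ⟨w', hw', hww'⟩ :=
    ((hperfect W hW w hw).sdiff (finite_range_iterate hn₀ hwn₀)).nonempty
  have hacc : ∀ v ∈ W ∩ M, ∀ G, IsOpen G → v ∈ G →
      (G ∩ {x ∈ M | (f ^ k) x = x}).Infinite := fun v hv G hG hvG =>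
    (hperfect (G ∩ W) (hG.inter hW) v ⟨⟨hvG, hv.1⟩, hv.2⟩).mono
      fun x hx => ⟨hx.1.1, hx.2, hWfix x ⟨hx.1.2, hx.2⟩⟩
  obtain ⟨B, B', hB, hwB, hB', hwB', hBB'⟩ := exists_isOpen_iterate_notMem f k
    (w := w) (w' := w') fun c _ h => hww' ⟨c, by rw [← h, f.coe_npow]⟩
  obtain ⟨n, h1, h2⟩ :=
    ((eventually_exists_sojourn hreg f k Mseq hMn M hlow w (hacc w hw) B hB hwB).and
      (eventually_exists_sojourn hreg f k Mseq hMn M hlow w' (hacc w' hw') B' hB' hwB')).exists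
  obtain ⟨z, hz⟩ := (hMn n).1
  obtain ⟨T, hT⟩ := h1 z hz
  obtain ⟨T', hT'⟩ := h2 z hz
  exact false_of_two_sojourns f hk hBB' z T T' hT hT'
end
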